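/- arXiv:0908.4457 — 4 statements merged into one kernel-verified Lean document; each statement's English description precedes it below -/
import Mathlib

section
/- For every w and every n ≥ K(w), the number of programs p of length exactly n with Φ(p) = w is at most 2^{n − K(w,n) + O(1)}. -/
open Encodable

/-- An optimal universal prefix-free interpreter: programs are binary strings,
conditions and outputs are natural numbers (under fixed computable encodings). -/
structure OptimalInterpreter where
  Φ : List Bool → ℕ → Part ℕ
  partrec : Partrec₂ Φ
  prefixFree : ∀ (y : ℕ) (p q : List Bool), p <+: q → (Φ p y).Dom → (Φ q y).Dom → p = q
  onto : ∀ x y : ℕ, ∃ p : List Bool, x ∈ Φ p y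
  optimal : ∀ ψ : List Bool → ℕ → Part ℕ, Partrec₂ ψ →
      (∀ (y : ℕ) (p q : List Bool), p <+: q → (ψ p y).Dom → (ψ q y).Dom → p = q) →
      ∃ c : ℕ, ∀ (x y : ℕ) (p : List Bool), x ∈ ψ p y →
        ∃ q : List Bool, x ∈ Φ q y ∧ q.length ≤ p.length + c

namespace OptimalInterpreter

variable (U : OptimalInterpreter)

/-- Conditional prefix-free Kolmogorov complexity `K(x|y)`. -/
noncomputable def K (x y : ℕ) : ℕ :=
  sInf {n | ∃ p : List Bool, p.length = n ∧ x ∈ U.Φ p y}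

/-- Plain (unconditional) prefix-free complexity `K(x)` (condition `0` encodes ε). -/
noncomputable def Kp (x : ℕ) : ℕ := U.K x 0

/-- `star x y` = the lexicographically (by code) first shortest program `p`
with `Φ(p|y) = x`, i.e. the witness `x*[y]`. -/
noncomputable def star (x y : ℕ) : List Bool :=
  ((Encodable.decode (α := List Bool)
      (sInf {n | ∃ p : List Bool, Encodable.encode p = n ∧
        p.length = U.K x y ∧ x ∈ U.Φ p y})).getD [])

end OptimalInterpreter


namespace CSP

def val (q : List Bool) : ℕ := q.foldl (fun v b => 2 * v + cond b 1 0) 0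

lemma val_foldl (t : List Bool) : ∀ v : ℕ,
    t.foldl (fun v b => 2 * v + cond b 1 0) v = v * 2 ^ t.length + val t := by
  induction t with
  | nil => intro v; simp [val]
  | cons b t ih =>
    intro v
    have h1 := ih (2 * v + cond b 1 0)
    have h2 := ih (2 * 0 + cond b 1 0)
    simp only [List.foldl_cons, List.length_cons, val] at *
    rw [h1, h2]; ring

lemma val_append (p t : List Bool) : val (p ++ t) = val p * 2 ^ t.length + val t := by
  rw [← val_foldl, val, List.foldl_append]; rfl

lemma val_lt (q : List Bool) : val q < 2 ^ q.length := by
  induction q using List.reverseRecOn with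
  | nil => simp [val]
  | append_singleton l b ih =>
    rw [val_append]
    cases b <;> simp [val, pow_succ] at * <;> omega

lemma exists_val : ∀ (L m : ℕ), m < 2 ^ L → ∃ q : List Bool, q.length = L ∧ val q = m := by
  intro L
  induction L with
  | zero => intro m hm; exact ⟨[], rfl, by simp at hm; simp [val, hm]⟩
  | succ L ih =>
    intro m hm
    obtain ⟨q, hq, hv⟩ := ih (m / 2) (by rw [pow_succ] at hm; omega)
    refine ⟨q ++ [decide (m % 2 = 1)], by simp [hq], ?_⟩
    rw [val_append, hv]
    by_cases h : m % 2 = 1 <;> simp [val, h] <;> omega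

lemma primrec_val : Primrec val := by
  have : Primrec fun q : List Bool => q.foldl (fun v b => 2 * v + cond b 1 0) 0 :=
    Primrec.list_foldl Primrec.id (Primrec.const 0)
      (h := fun _ (x : ℕ × Bool) => 2 * x.1 + cond x.2 1 0)
      ((Primrec.nat_add.comp
        (Primrec.nat_mul.comp (Primrec.const 2) (Primrec.fst.comp Primrec.snd))
        (Primrec.cond (Primrec.snd.comp Primrec.snd) (Primrec.const 1) (Primrec.const 0))).to₂)
  exact this

lemma primrec_pow : Primrec₂ (fun a b : ℕ => a ^ b) := Primrec₂.unpaired'.1 Nat.Primrec.pow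

/-- Kraft for prefix-free finite sets. -/
lemma kraft (S : Finset (List Bool))
    (h : ∀ p ∈ S, ∀ q ∈ S, p <+: q → p = q) : ∑ p ∈ S, (1 / 2 : ℝ) ^ p.length ≤ 1 := by
  by_cases he : [] ∈ S
  · have : S = {[]} := by
      ext q; simp only [Finset.mem_singleton]
      exact ⟨fun hq => (h _ he _ hq (List.nil_prefix)).symm, fun hq => hq ▸ he⟩
    simp [this]
  · have hU : InformationTheory.UniquelyDecodable (S : Set (List Bool)) := by
      intro L₁
      induction L₁ with
      | nil =>
        intro L₂ _ h2 hf
        cases L₂ with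
        | nil => rfl
        | cons a L₂ =>
          simp at hf
          exact absurd (h2 a (by simp)) (by simpa [hf.1] using he)
      | cons a L₁ ih =>
        intro L₂ h1 h2 hf
        cases L₂ with
        | nil =>
          simp at hf
          exact absurd (h1 a (by simp)) (by simpa [hf.1] using he)
        | cons b L₂ =>
          have ha := h1 a (by simp)
          have hb := h2 b (by simp)
          simp only [List.flatten_cons] at hf
          have hab : a = b := by
            rcases List.prefix_or_prefix_of_prefix (List.prefix_append a L₁.flatten)
              (hf ▸ List.prefix_append b L₂.flatten) with hp | hp
            · exact h _ ha _ hb hp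
            · exact (h _ hb _ ha hp).symm
          subst hab
          rw [ih L₂ (fun w hw => h1 w (by simp [hw])) (fun w hw => h2 w (by simp [hw]))
            (List.append_cancel_left hf)]
    simpa using InformationTheory.kraft_mcmillan_inequality hU

section KC
variable (valid : ℕ → Bool) (r t : ℕ → ℕ)

noncomputable def alpha (i : ℕ) : ℝ := ∑ j ∈ Finset.range i, if valid j then (1/2 : ℝ) ^ r j else 0

def A (i : ℕ) : ℕ :=
  Nat.rec (motive := fun _ => ℕ) 0
    (fun i x => 2 * x + cond (valid i) (2 ^ (i + 2 - r i)) 0) i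

def mm (i : ℕ) : ℕ := (A valid r i * 2 ^ (r i + 1) + (2 ^ (i + 1) - 1)) / 2 ^ (i + 1)

def codes (q : List Bool) (i : ℕ) : Option ℕ :=
  if valid i = true ∧ q.length = r i + 1 ∧ val q = mm valid r i then some (t i) else none

variable {valid r t}

lemma alpha_A (hr : ∀ i, r i ≤ i + 1) (i : ℕ) : alpha valid r i * 2 ^ (i + 1) = A valid r i := by
  induction i with
  | zero => simp [alpha, A]
  | succ i ih =>
    have h1 : A valid r (i + 1) = 2 * A valid r i + cond (valid i) (2 ^ (i + 2 - r i)) 0 := rfl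
    have h2 : alpha valid r (i + 1) = alpha valid r i + if valid i then (1/2 : ℝ) ^ r i else 0 := by
      simp [alpha, Finset.sum_range_succ]
    rw [h1, h2]
    push_cast
    rw [← ih]
    have h3 : (2 : ℝ) ^ (i + 2) = 2 ^ (i + 2 - r i) * 2 ^ r i := by
      rw [← pow_add]; congr 1; have := hr i; omega
    cases hv : valid i
    · simp; ring
    · simp only [if_true, cond_true]
      rw [show i + 1 + 1 = i + 2 from rfl, add_mul, h3]
      have : (1/2 : ℝ) ^ r i * (2 ^ (i + 2 - r i) * 2 ^ r i) = 2 ^ (i + 2 - r i) := by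
        rw [mul_comm, mul_assoc, ← mul_pow]; norm_num
      rw [this, ← h3]; push_cast; ring

lemma mm_bounds (hr : ∀ i, r i ≤ i + 1) (i : ℕ) :
    alpha valid r i ≤ mm valid r i / 2 ^ (r i + 1) ∧
      (mm valid r i + 1) / 2 ^ (r i + 1) < alpha valid r i + (1/2 : ℝ) ^ r i := by
  have hA := alpha_A (valid := valid) hr i
  set D := 2 ^ (i + 1) with hD
  have hDpos : 0 < D := by positivity
  set X := A valid r i * 2 ^ (r i + 1) with hX
  have hm : mm valid r i = (X + (D - 1)) / D := rfl
  have e1 : X ≤ mm valid r i * D := by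
    have := Nat.div_add_mod (X + (D - 1)) D
    have h2 := Nat.mod_lt (X + (D - 1)) hDpos
    rw [← hm, mul_comm] at this; omega
  have e2 : mm valid r i * D < X + D := by
    have := Nat.div_mul_le_self (X + (D - 1)) D
    rw [← hm] at this; omega
  have e1' : (X : ℝ) ≤ mm valid r i * D := by exact_mod_cast e1
  have e2' : (mm valid r i * D : ℝ) < X + D := by exact_mod_cast e2
  have hXr : (X : ℝ) = alpha valid r i * 2 ^ (r i + 1) * D := by
    rw [hX, hD]; push_cast; rw [← hA]; ring
  have hDr : (0 : ℝ) < D := by exact_mod_cast hDpos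
  rw [hXr] at e1' e2'
  have f1 := le_of_mul_le_mul_right e1' hDr
  have f2 : (mm valid r i : ℝ) < alpha valid r i * 2 ^ (r i + 1) + 1 := by
    apply lt_of_mul_lt_mul_right _ hDr.le; linarith
  have hp : (0 : ℝ) < 2 ^ (r i + 1) := by positivity
  refine ⟨by rwa [le_div_iff₀ hp], ?_⟩
  rw [div_lt_iff₀ hp, add_mul]
  have : (1/2 : ℝ) ^ r i * 2 ^ (r i + 1) = 2 := by
    rw [pow_succ, ← mul_assoc, ← mul_pow]; norm_num
  rw [this]; linarith

lemma alpha_mono : Monotone (alpha valid r) := by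
  refine monotone_nat_of_le_succ fun i => ?_
  simp only [alpha, Finset.sum_range_succ]
  have : (0 : ℝ) ≤ if valid i then (1/2 : ℝ) ^ r i else 0 := by split_ifs <;> positivity
  linarith

lemma alpha_succ {i : ℕ} (h : valid i = true) :
    alpha valid r (i + 1) = alpha valid r i + (1/2 : ℝ) ^ r i := by
  simp [alpha, Finset.sum_range_succ, h]

lemma codes_mem {q : List Bool} {i x : ℕ} : x ∈ codes valid r t q i ↔
    (valid i = true ∧ q.length = r i + 1 ∧ val q = mm valid r i) ∧ t i = x := by
  simp [codes]

lemma codes_unique (hr : ∀ i, r i ≤ i + 1) {p q : List Bool} {i j : ℕ} (hpq : p <+: q)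
    (hi : valid i = true ∧ p.length = r i + 1 ∧ val p = mm valid r i)
    (hj : valid j = true ∧ q.length = r j + 1 ∧ val q = mm valid r j) : i = j := by
  obtain ⟨hi0, hi1, hi2⟩ := hi
  obtain ⟨hj0, hj1, hj2⟩ := hj
  have bi := mm_bounds (valid := valid) hr i
  have bj := mm_bounds (valid := valid) hr j
  rw [← alpha_succ hi0, ← hi1, ← hi2] at bi
  rw [← alpha_succ hj0, ← hj1, ← hj2] at bj
  obtain ⟨u, rfl⟩ := hpq
  have hv := val_append p u
  have hu := val_lt u
  have hvr : (val (p ++ u) : ℝ) = val p * 2 ^ u.length + val u := by exact_mod_cast hv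
  have hur : (val u : ℝ) < 2 ^ u.length := by exact_mod_cast hu
  have hu0 : (0 : ℝ) ≤ val u := by positivity
  have g0 : (0 : ℝ) < 2 ^ (p ++ u).length := by positivity
  have hl : (2 : ℝ) ^ (p ++ u).length = 2 ^ p.length * 2 ^ u.length := by
    rw [List.length_append, pow_add]
  have gp : (0 : ℝ) < 2 ^ p.length := by positivity
  have g1 : (val p : ℝ) / 2 ^ p.length ≤ val (p ++ u) / 2 ^ (p ++ u).length := by
    rw [div_le_div_iff₀ gp g0, hl, hvr]; nlinarith
  have g2 : (val (p ++ u) : ℝ) / 2 ^ (p ++ u).length < (val p + 1) / 2 ^ p.length := by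
    rw [div_lt_div_iff₀ g0 gp, hl, hvr]; nlinarith
  have g3 : (val (p ++ u) : ℝ) / 2 ^ (p ++ u).length < (val (p ++ u) + 1) / 2 ^ (p ++ u).length := by
    apply div_lt_div_of_pos_right _ g0; linarith
  rcases lt_trichotomy i j with h | h | h
  · have := alpha_mono (valid := valid) (r := r) (Nat.succ_le_of_lt h)
    simp only [Nat.succ_eq_add_one] at this
    linarith [bi.2, bj.1]
  · exact h
  · have := alpha_mono (valid := valid) (r := r) (Nat.succ_le_of_lt h)
    simp only [Nat.succ_eq_add_one] at this
    linarith [bj.2, bi.1]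

lemma primrec_A (hv : Primrec valid) (hr : Primrec r) : Primrec (A valid r) := by
  refine Primrec.nat_rec₁ 0 ?_
  exact (Primrec.nat_add.comp (Primrec.nat_mul.comp (Primrec.const 2) Primrec.snd)
    (Primrec.cond (hv.comp Primrec.fst) (primrec_pow.comp (Primrec.const 2)
      (Primrec.nat_sub.comp (Primrec.nat_add.comp Primrec.fst (Primrec.const 2))
        (hr.comp Primrec.fst))) (Primrec.const 0))).to₂

lemma primrec_mm (hv : Primrec valid) (hr : Primrec r) : Primrec (mm valid r) := by
  have h2 : Primrec fun i : ℕ => 2 ^ (i + 1) := primrec_pow.comp (Primrec.const 2) Primrec.succ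
  exact Primrec.nat_div.comp (Primrec.nat_add.comp
    (Primrec.nat_mul.comp (primrec_A hv hr) (h2.comp hr))
    (Primrec.nat_sub.comp h2 (Primrec.const 1))) h2

lemma primrec_codes (hv : Primrec valid) (hr : Primrec r) (ht : Primrec t) :
    Primrec₂ (codes valid r t) := by
  refine Primrec.ite ?_ (Primrec.option_some.comp (ht.comp Primrec.snd)) (Primrec.const none)
  refine PrimrecPred.and ?_ (PrimrecPred.and ?_ ?_)
  · exact Primrec.eq.comp (hv.comp Primrec.snd) (Primrec.const true)
  · exact Primrec.eq.comp (Primrec.list_length.comp Primrec.fst)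
      (Primrec.succ.comp (hr.comp Primrec.snd))
  · exact Primrec.eq.comp (primrec_val.comp Primrec.fst) ((primrec_mm hv hr).comp Primrec.snd)

theorem kraft_chaitin (U : OptimalInterpreter) (hv : Primrec valid) (hr : Primrec r)
    (ht : Primrec t) (hri : ∀ i, r i ≤ i + 1) (hs : ∀ i, alpha valid r i ≤ 1) :
    ∃ c, ∀ i, valid i = true → U.Kp (t i) ≤ r i + c := by
  let ψ : List Bool → ℕ → Part ℕ := fun q _ => Nat.rfindOpt (codes valid r t q)
  have hψ : Partrec₂ ψ :=
    (Partrec.rfindOpt (primrec_codes hv hr ht).to_comp).comp Computable.fst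
  obtain ⟨c, hc⟩ := U.optimal ψ hψ (by
    intro y p q hpq hp hq
    obtain ⟨i, x, hi⟩ := Nat.rfindOpt_dom.1 hp
    obtain ⟨j, x', hj⟩ := Nat.rfindOpt_dom.1 hq
    rw [codes_mem] at hi hj
    have := codes_unique hri hpq hi.1 hj.1
    subst this
    exact hpq.eq_of_length (hi.1.2.1.trans hj.1.2.1.symm))
  refine ⟨c + 1, fun i hi => ?_⟩
  have hb := mm_bounds (valid := valid) hri i
  have hlt : mm valid r i < 2 ^ (r i + 1) := by
    have h1 := hs (i + 1)
    rw [alpha_succ hi] at h1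
    have h2 := hb.2.trans_le h1
    rw [div_lt_one (by positivity)] at h2
    have : (mm valid r i : ℝ) < 2 ^ (r i + 1) := by linarith
    exact_mod_cast this
  obtain ⟨q, hq1, hq2⟩ := exists_val _ _ hlt
  have hq : t i ∈ codes valid r t q i := codes_mem.2 ⟨⟨hi, hq1, hq2⟩, rfl⟩
  have hmem : t i ∈ ψ q 0 := by
    have hd : (ψ q 0).Dom := Nat.rfindOpt_dom.2 ⟨i, _, hq⟩
    obtain ⟨j, hj⟩ := Nat.rfindOpt_spec (Part.get_mem hd)
    have hj' := codes_mem.1 hj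
    have := codes_unique hri List.prefix_rfl ⟨hi, hq1, hq2⟩ hj'.1
    subst this
    rw [hj'.2]
    exact Part.get_mem hd
  obtain ⟨q', h1, h2⟩ := hc _ _ _ hmem
  have : U.Kp (t i) ≤ q'.length := Nat.sInf_le ⟨q', rfl, h1⟩
  omega

end KC

section Count
open Nat.Partrec (Code)

/-- The programs of length `n` with output `w`. -/
def progs (U : OptimalInterpreter) (b : ℕ × ℕ) : Set (List Bool) :=
  {p : List Bool | p.length = b.2 ∧ b.1 ∈ U.Φ p 0}

lemma progs_finite (U : OptimalInterpreter) (b : ℕ × ℕ) : (progs U b).Finite :=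
  (List.finite_length_eq Bool b.2).subset fun _ hp => hp.1

/-- `a` codes a program of length `n`, seen to output `w` within `s` steps. -/
def Seen (c : Code) (w n s a : ℕ) : Prop :=
  c.evaln s a = some w ∧
    (decode (α := List Bool) a).map (fun p => (encode p, p.length)) = some (a, n)

instance (c : Code) (w n s : ℕ) : DecidablePred (Seen c w n s) := fun a => by
  unfold Seen; infer_instance

def N (c : Code) (s w n : ℕ) : ℕ := Nat.count (Seen c w n s) s

def IsCode (U : OptimalInterpreter) (c : Code) : Prop :=
  ∀ p : List Bool, c.eval (encode p) = U.Φ p 0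

lemma exists_isCode (U : OptimalInterpreter) : ∃ c, IsCode U c := by
  have h : Partrec fun p : List Bool => U.Φ p 0 :=
    U.partrec.comp Computable.id (Computable.const 0)
  obtain ⟨c, hc⟩ := Code.exists_code.1 h
  refine ⟨c, fun p => ?_⟩
  rw [hc]
  simp [Part.map_id']

lemma seen_iff {c : Code} {w n s a : ℕ} : Seen c w n s a ↔
    c.evaln s a = some w ∧ ∃ p : List Bool, encode p = a ∧ p.length = n := by
  unfold Seen
  refine and_congr_right fun _ => ?_
  constructor
  · intro h
    simp only [Option.map_eq_some_iff, Prod.mk.injEq] at h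
    obtain ⟨p, _, h1, h2⟩ := h
    exact ⟨p, h1, h2⟩
  · rintro ⟨p, rfl, rfl⟩
    simp

variable {U : OptimalInterpreter} {c : Code}

lemma N_eq (s w n : ℕ) : N c s w n = ((Finset.range s).filter (Seen c w n s)).card :=
  Nat.count_eq_card_filter_range _ _

lemma N_le (hc : IsCode U c) (s w n : ℕ) : N c s w n ≤ (progs U (w, n)).ncard := by
  rw [N_eq, ← Set.ncard_coe_finset, ← Set.ncard_image_of_injective (progs U (w, n)) encode_injective]
  refine Set.ncard_le_ncard ?_ ((progs_finite U _).image _)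
  intro a ha
  simp only [Finset.coe_filter, Set.mem_setOf_eq, seen_iff] at ha
  obtain ⟨_, h1, p, rfl, h2⟩ := ha
  refine ⟨p, ⟨h2, ?_⟩, rfl⟩
  rw [← hc p]
  exact Code.evaln_sound h1

lemma N_mono (w n : ℕ) : Monotone fun s => N c s w n := by
  intro s s' hs
  simp only [N_eq]
  refine Finset.card_le_card fun a ha => ?_
  simp only [Finset.mem_filter, Finset.mem_range, seen_iff] at ha ⊢
  exact ⟨ha.1.trans_le hs, Code.evaln_mono hs ha.2.1, ha.2.2⟩

lemma exists_N (hc : IsCode U c) (w n : ℕ) : ∃ s, (progs U (w, n)).ncard ≤ N c s w n := by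
  have h : ∀ p : List Bool, ∃ s, p ∈ progs U (w, n) → c.evaln s (encode p) = some w := by
    intro p
    by_cases hp : p ∈ progs U (w, n)
    · have h1 : w ∈ c.eval (encode p) := by rw [hc p]; exact hp.2
      obtain ⟨s, hs⟩ := Code.evaln_complete.1 h1
      exact ⟨s, fun _ => hs⟩
    · exact ⟨0, fun h => absurd h hp⟩
  choose f hf using h
  refine ⟨(progs_finite U (w, n)).toFinset.sup f, ?_⟩
  rw [N_eq, ← Set.ncard_coe_finset, ← Set.ncard_image_of_injective (progs U (w, n)) encode_injective]
  refine Set.ncard_le_ncard ?_ (Finset.finite_toSet _)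
  rintro _ ⟨p, hp, rfl⟩
  have hle : f p ≤ (progs_finite U (w, n)).toFinset.sup f := Finset.le_sup (by simpa using hp)
  have he := Code.evaln_mono hle (hf p hp)
  simp only [Finset.coe_filter, Set.mem_setOf_eq, seen_iff, Finset.mem_range]
  exact ⟨Code.evaln_bound he, he, p, rfl, hp.1⟩

lemma primrec_N : Primrec fun x : ℕ × ℕ × ℕ => N c x.1 x.2.1 x.2.2 := by
  have hseen : PrimrecPred fun y : (ℕ × ℕ × ℕ) × ℕ => Seen c y.1.2.1 y.1.2.2 y.1.1 y.2 := by
    refine PrimrecPred.and ?_ ?_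
    · refine Primrec.eq.comp ?_ ?_
      · exact Code.primrec_evaln.comp (Primrec.pair (Primrec.pair
          (Primrec.fst.comp Primrec.fst) (Primrec.const c)) Primrec.snd)
      · exact Primrec.option_some.comp (Primrec.fst.comp (Primrec.snd.comp Primrec.fst))
    · refine Primrec.eq.comp ?_ ?_
      · exact Primrec.option_map (Primrec.decode.comp Primrec.snd)
          ((Primrec.pair Primrec.encode Primrec.list_length).comp Primrec.snd).to₂
      · exact Primrec.option_some.comp (Primrec.pair Primrec.snd
          (Primrec.snd.comp (Primrec.snd.comp Primrec.fst)))
  have h := Primrec.nat_rec' (f := fun x : ℕ × ℕ × ℕ => x.1) (g := fun _ => 0)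
    (h := fun x (y : ℕ × ℕ) => y.2 + if Seen c x.2.1 x.2.2 x.1 y.1 then 1 else 0)
    Primrec.fst (Primrec.const 0)
    ((Primrec.nat_add.comp (Primrec.snd.comp Primrec.snd)
      (Primrec.ite (hseen.comp (Primrec.pair Primrec.fst (Primrec.fst.comp Primrec.snd)))
        (Primrec.const 1) (Primrec.const 0))).to₂)
  refine h.of_eq fun x => ?_
  unfold N
  generalize hs : x.1 = s
  have : ∀ m : ℕ, Nat.rec (motive := fun _ => ℕ) 0
      (fun y IH => IH + if Seen c x.2.1 x.2.2 s y then 1 else 0) m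
      = Nat.count (Seen c x.2.1 x.2.2 s) m := by
    intro m
    induction m with
    | zero => simp
    | succ m ih => rw [Nat.count_succ, ← ih]
  exact this s

def rs (i : ℕ) : ℕ := i.unpair.1
def rw' (i : ℕ) : ℕ := i.unpair.2.unpair.1
def rn (i : ℕ) : ℕ := i.unpair.2.unpair.2.unpair.1
def rk (i : ℕ) : ℕ := i.unpair.2.unpair.2.unpair.2

def ok (c : Code) (i : ℕ) : Bool :=
  decide (rk i ≤ rn i ∧ N c (rs i) (rw' i) (rn i) < 2 ^ rk i ∧
    2 ^ rk i ≤ N c (rs i + 1) (rw' i) (rn i))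

def rr (i : ℕ) : ℕ := rn i - rk i + 1
def tt (i : ℕ) : ℕ := Nat.pair (rw' i) (rn i)

lemma primrec_rs : Primrec rs := Primrec.fst.comp Primrec.unpair
lemma primrec_rw : Primrec rw' :=
  Primrec.fst.comp (Primrec.unpair.comp (Primrec.snd.comp Primrec.unpair))
lemma primrec_rn : Primrec rn :=
  Primrec.fst.comp (Primrec.unpair.comp (Primrec.snd.comp
    (Primrec.unpair.comp (Primrec.snd.comp Primrec.unpair))))
lemma primrec_rk : Primrec rk :=
  Primrec.snd.comp (Primrec.unpair.comp (Primrec.snd.comp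
    (Primrec.unpair.comp (Primrec.snd.comp Primrec.unpair))))

lemma primrec_rr : Primrec rr :=
  Primrec.succ.comp (Primrec.nat_sub.comp primrec_rn primrec_rk)

lemma primrec_tt : Primrec tt := Primrec₂.natPair.comp primrec_rw primrec_rn

lemma primrec_ok : Primrec (ok c) := by
  have h2 : Primrec fun i => 2 ^ rk i := primrec_pow.comp (Primrec.const 2) primrec_rk
  refine PrimrecPred.decide (PrimrecPred.and ?_ (PrimrecPred.and ?_ ?_))
  · exact Primrec.nat_le.comp primrec_rk primrec_rn
  · exact Primrec.nat_lt.comp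
      (primrec_N.comp (Primrec.pair primrec_rs (Primrec.pair primrec_rw primrec_rn))) h2
  · exact Primrec.nat_le.comp h2 (primrec_N.comp
      (Primrec.pair (Primrec.succ.comp primrec_rs) (Primrec.pair primrec_rw primrec_rn)))

lemma rr_le (i : ℕ) : rr i ≤ i + 1 := by
  have : rn i ≤ i := (Nat.unpair_left_le _).trans
    ((Nat.unpair_right_le _).trans (Nat.unpair_right_le _))
  unfold rr; omega

lemma sum_progs (S : Finset (ℕ × ℕ)) :
    ∑ b ∈ S, ((progs U b).ncard : ℝ) * (1 / 2) ^ b.2 ≤ 1 := by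
  classical
  have h1 : ∀ b ∈ S, ((progs U b).ncard : ℝ) * (1 / 2) ^ b.2 =
      ∑ p ∈ (progs_finite U b).toFinset, (1 / 2 : ℝ) ^ p.length := by
    intro b _
    rw [Finset.sum_congr rfl (g := fun _ => (1 / 2 : ℝ) ^ b.2)]
    · rw [Finset.sum_const, nsmul_eq_mul, Set.ncard_eq_toFinset_card _ (progs_finite U b)]
    · intro p hp
      rw [Set.Finite.mem_toFinset] at hp
      rw [hp.1]
  rw [Finset.sum_congr rfl h1, ← Finset.sum_biUnion]
  · refine kraft _ ?_
    intro p hp q hq hpq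
    simp only [Finset.mem_biUnion, Set.Finite.mem_toFinset] at hp hq
    obtain ⟨b, _, hp⟩ := hp
    obtain ⟨b', _, hq⟩ := hq
    exact U.prefixFree 0 p q hpq (Part.dom_iff_mem.2 ⟨_, hp.2⟩) (Part.dom_iff_mem.2 ⟨_, hq.2⟩)
  · intro b _ b' _ hne
    refine Finset.disjoint_left.2 fun p hp hq => hne ?_
    rw [Set.Finite.mem_toFinset] at hp hq
    exact Prod.ext (Part.mem_unique hp.2 hq.2) (hp.1.symm.trans hq.1)

lemma alpha_le (hc : IsCode U c) (i : ℕ) : alpha (ok c) rr i ≤ 1 := by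
  classical
  unfold alpha
  rw [← Finset.sum_filter]
  set J := (Finset.range i).filter (fun j => ok c j = true) with hJ
  let g : ℕ → (Σ _ : ℕ × ℕ, ℕ) := fun j => ⟨(rw' j, rn j), rk j⟩
  let f : (Σ _ : ℕ × ℕ, ℕ) → ℝ := fun x => 2 ^ x.2 * (1 / 2) ^ (x.1.2 + 1)
  have hok : ∀ j ∈ J, rk j ≤ rn j ∧ N c (rs j) (rw' j) (rn j) < 2 ^ rk j ∧
      2 ^ rk j ≤ N c (rs j + 1) (rw' j) (rn j) := by
    intro j hj
    have := (Finset.mem_filter.1 hj).2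
    simpa [ok] using this
  have hinj : Set.InjOn g J := by
    intro a ha b hb hab
    obtain ⟨-, ha1, ha2⟩ := hok a ha
    obtain ⟨-, hb1, hb2⟩ := hok b hb
    simp only [g, Sigma.mk.injEq, Prod.mk.injEq, heq_eq_eq] at hab
    obtain ⟨⟨e1, e2⟩, e3⟩ := hab
    rw [e1, e2, e3] at ha1 ha2
    have es : rs a = rs b := by
      rcases lt_trichotomy (rs a) (rs b) with h | h | h
      · have := N_mono (c := c) (rw' b) (rn b) (Nat.succ_le_of_lt h)
        simp only [Nat.succ_eq_add_one] at this
        omega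
      · exact h
      · have := N_mono (c := c) (rw' b) (rn b) (Nat.succ_le_of_lt h)
        simp only [Nat.succ_eq_add_one] at this
        omega
    have key : ∀ j, j = Nat.pair (rs j) (Nat.pair (rw' j) (Nat.pair (rn j) (rk j))) := by
      intro j; simp [rs, rw', rn, rk]
    rw [key a, key b, es, e1, e2, e3]
  have h1 : ∑ j ∈ J, (1 / 2 : ℝ) ^ rr j = ∑ x ∈ J.image g, f x := by
    rw [Finset.sum_image hinj]
    refine Finset.sum_congr rfl fun j hj => ?_
    have hle := (hok j hj).1
    simp only [f, g, rr]
    have : rn j + 1 = rk j + (rn j - rk j + 1) := by omega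
    rw [this, pow_add (1 / 2 : ℝ) (rk j), ← mul_assoc, ← mul_pow]
    norm_num
  let S := J.image (fun j => (rw' j, rn j))
  have hM : ∀ j ∈ J, 2 ^ rk j ≤ (progs U (rw' j, rn j)).ncard := fun j hj =>
    (hok j hj).2.2.trans (N_le hc _ _ _)
  have hsub : J.image g ⊆ S.sigma fun b => Finset.range (Nat.log 2 (progs U b).ncard + 1) := by
    intro x hx
    obtain ⟨j, hj, rfl⟩ := Finset.mem_image.1 hx
    simp only [Finset.mem_sigma, Finset.mem_range, g]
    refine ⟨Finset.mem_image_of_mem _ hj, Nat.lt_succ_of_le ?_⟩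
    have := hM j hj
    exact Nat.le_log_of_pow_le (by norm_num) this
  rw [h1]
  refine (Finset.sum_le_sum_of_subset_of_nonneg hsub
    (fun x _ _ => by simp only [f]; positivity)).trans ?_
  rw [Finset.sum_sigma]
  refine le_trans (Finset.sum_le_sum ?_) (sum_progs (U := U) S)
  intro b hb
  obtain ⟨j, hj, rfl⟩ := Finset.mem_image.1 hb
  have hpos : (progs U (rw' j, rn j)).ncard ≠ 0 := by
    have := hM j hj
    have h2 : 0 < 2 ^ rk j := by positivity
    omega
  simp only [f]
  rw [← Finset.sum_mul, geom_sum_eq (by norm_num)]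
  have hl : (2 : ℝ) ^ Nat.log 2 (progs U (rw' j, rn j)).ncard ≤ (progs U (rw' j, rn j)).ncard := by
    exact_mod_cast Nat.pow_log_le_self 2 hpos
  have hp : (0 : ℝ) < (1 / 2) ^ rn j := by positivity
  rw [pow_succ, pow_succ]
  nlinarith

end Count

end CSP

/-- For every `w` and `n ≥ K(w)`, the number of programs of length exactly `n`
outputting `w` is at most `2^{n − K(w,n) + O(1)}`. -/
theorem counting_shortest_programs (U : OptimalInterpreter) :
    ∃ C : ℕ, ∀ w n : ℕ, U.Kp w ≤ n →
      {p : List Bool | p.length = n ∧ w ∈ U.Φ p 0}.ncard ≤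
        2 ^ (n + C - U.Kp (Nat.pair w n)) := by
  classical
  obtain ⟨c, hc⟩ := CSP.exists_isCode U
  obtain ⟨d, hd⟩ := CSP.kraft_chaitin U (CSP.primrec_ok (c := c)) CSP.primrec_rr CSP.primrec_tt
    CSP.rr_le (CSP.alpha_le hc)
  refine ⟨d + 2, fun w n _ => ?_⟩
  change (CSP.progs U (w, n)).ncard ≤ _
  set M := (CSP.progs U (w, n)).ncard with hM
  by_cases h0 : M = 0
  · rw [h0]; exact Nat.zero_le _
  have hlo : 2 ^ Nat.log 2 M ≤ M := Nat.pow_log_le_self 2 h0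
  have hhi : M < 2 ^ (Nat.log 2 M + 1) := Nat.lt_pow_succ_log_self (by norm_num) M
  set k := Nat.log 2 M with hk
  have hMn : M ≤ 2 ^ n := by
    have h1 := CSP.sum_progs (U := U) {(w, n)}
    rw [Finset.sum_singleton] at h1
    have h2 : ((1 / 2 : ℝ)) ^ n * 2 ^ n = 1 := by rw [← mul_pow]; norm_num
    have h3 : (0 : ℝ) < 2 ^ n := by positivity
    have h4 : (M : ℝ) ≤ 2 ^ n := by
      have h5 := mul_le_mul_of_nonneg_right h1 h3.le
      rw [mul_assoc] at h5
      simp only at h5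
      rw [h2] at h5
      linarith
    exact_mod_cast h4
  have hkn : k ≤ n := (Nat.pow_le_pow_iff_right (by norm_num)).1 (hlo.trans hMn)
  have hex : ∃ s, 2 ^ k ≤ CSP.N c s w n := by
    obtain ⟨s, hs⟩ := CSP.exists_N hc w n
    exact ⟨s, hlo.trans hs⟩
  have hspec := Nat.find_spec hex
  have hmin : ∀ m, m < Nat.find hex → ¬ 2 ^ k ≤ CSP.N c m w n := fun m => Nat.find_min hex
  obtain ⟨s, hs⟩ : ∃ s, Nat.find hex = s + 1 := by
    refine Nat.exists_eq_succ_of_ne_zero fun h => ?_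
    rw [h] at hspec
    have h2 : 0 < 2 ^ k := by positivity
    simp [CSP.N] at hspec
  rw [hs] at hspec
  have hlt := hmin s (by omega)
  have := hd (Nat.pair s (Nat.pair w (Nat.pair n k))) (by
    simp only [CSP.ok, CSP.rs, CSP.rw', CSP.rn, CSP.rk, Nat.unpair_pair, decide_eq_true_eq]
    exact ⟨hkn, not_le.1 hlt, hspec⟩)
  simp only [CSP.rr, CSP.tt, CSP.rw', CSP.rn, CSP.rk, Nat.unpair_pair] at this
  refine hhi.le.trans (Nat.pow_le_pow_right (by norm_num) ?_)
  omega
end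

section
/- For every m and every w there exists a binary string x of length m such that K(K(x|w) | x, w) ≥ log m − log log m − O(1). -/
open Encodable

namespace HardStrings

open Nat.Partrec (Code)
open Nat.Partrec.Code

theorem primrec_filter {α β : Type*} [Primcodable α] [Primcodable β] {f : α → List β}
    {g : α → β → Bool} (hf : Primrec f) (hg : Primrec₂ g) :
    Primrec fun a => (f a).filter (g a) := by
  have : Primrec fun a => (f a).filterMap fun b => bif g a b then some b else none :=
    Primrec.listFilterMap hf (Primrec.cond hg (Primrec.option_some.comp Primrec.snd)
      (Primrec.const none))
  refine this.of_eq fun a => ?_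
  induction f a with
  | nil => rfl
  | cons b l ih => cases h : g a b <;> simp [h, ih]

theorem primrec_pow2 : Primrec fun n : ℕ => 2 ^ n := by
  have := (Primrec₂.unpaired'.1 Nat.Primrec.pow).comp (Primrec.const 2) Primrec.id
  exact this

/-- length of the string with a given code -/
def len (n : ℕ) : Option ℕ := (decode (α := List Bool) n).map List.length

theorem primrec_len : Primrec len :=
  Primrec.option_map Primrec.decode (Primrec.list_length.comp Primrec.snd)

/-- programs of length at most `s` that are seen within time `T` to output more than `thr` -/
def hits (c : Code) (s thr T y : ℕ) : List ℕ :=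
  (List.range T).filter fun p =>
    decide ((len p).getD 0 ≤ s) && decide (thr < (evaln T c (Nat.pair p y)).getD 0)

attribute [irreducible] hits

def pI (N : ℕ) : ℕ := N.unpair.1.unpair.1
def pM (N : ℕ) : ℕ := N.unpair.1.unpair.2
def pS (N : ℕ) : ℕ := N.unpair.2.unpair.1.unpair.1
def pT (N : ℕ) : ℕ := N.unpair.2.unpair.1.unpair.2
def pB (N : ℕ) : ℕ := N.unpair.2.unpair.2

def out (c : Code) (N w T : ℕ) : List ℕ :=
  (List.range T).filter fun x =>
    decide (len x = some (pM N)) &&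
      decide (pI N ≤ (hits c (pS N) (pT N) T (Nat.pair x w)).length)

attribute [irreducible] out

theorem primrec_l : Primrec fun N : ℕ => N.unpair.1 := Primrec.fst.comp Primrec.unpair
theorem primrec_r : Primrec fun N : ℕ => N.unpair.2 := Primrec.snd.comp Primrec.unpair
theorem primrec_pI : Primrec pI := primrec_l.comp primrec_l
theorem primrec_pM : Primrec pM := primrec_r.comp primrec_l
theorem primrec_pS : Primrec pS := primrec_l.comp (primrec_l.comp primrec_r)
theorem primrec_pT : Primrec pT := primrec_r.comp (primrec_l.comp primrec_r)
theorem primrec_pB : Primrec pB := primrec_r.comp primrec_r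

theorem primrec_hits (c : Code) :
    Primrec fun a : (ℕ × ℕ) × (ℕ × ℕ) => hits c a.1.1 a.1.2 a.2.1 a.2.2 := by
  unfold hits
  refine primrec_filter (Primrec.list_range.comp (Primrec.fst.comp Primrec.snd)) ?_
  refine Primrec.and.comp ?_ ?_
  · refine (Primrec.nat_le.decide).comp ?_ ?_
    · exact Primrec.option_getD.comp (primrec_len.comp Primrec.snd) (Primrec.const 0)
    · exact Primrec.fst.comp (Primrec.fst.comp Primrec.fst)
  · refine (Primrec.nat_lt.decide).comp ?_ ?_
    · exact Primrec.snd.comp (Primrec.fst.comp Primrec.fst)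
    · refine Primrec.option_getD.comp ?_ (Primrec.const 0)
      have h1 : Primrec fun q : ((ℕ × ℕ) × (ℕ × ℕ)) × ℕ =>
          ((q.1.2.1, c), Nat.pair q.2 q.1.2.2) :=
        Primrec.pair (Primrec.pair (Primrec.fst.comp (Primrec.snd.comp Primrec.fst))
          (Primrec.const c)) (Primrec₂.natPair.comp Primrec.snd
            (Primrec.snd.comp (Primrec.snd.comp Primrec.fst)))
      exact primrec_evaln.comp h1

theorem primrec_out (c : Code) :
    Primrec fun a : (ℕ × ℕ) × ℕ => out c a.1.1 a.1.2 a.2 := by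
  unfold out
  refine primrec_filter (Primrec.list_range.comp Primrec.snd) ?_
  have hN : Primrec fun q : ((ℕ × ℕ) × ℕ) × ℕ => q.1.1.1 :=
    Primrec.fst.comp (Primrec.fst.comp Primrec.fst)
  have hw : Primrec fun q : ((ℕ × ℕ) × ℕ) × ℕ => q.1.1.2 :=
    Primrec.snd.comp (Primrec.fst.comp Primrec.fst)
  have hT : Primrec fun q : ((ℕ × ℕ) × ℕ) × ℕ => q.1.2 := Primrec.snd.comp Primrec.fst
  refine Primrec.and.comp ?_ ?_
  · exact (Primrec.eq.decide).comp (primrec_len.comp Primrec.snd)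
      (Primrec.option_some.comp (primrec_pM.comp hN))
  · refine (Primrec.nat_le.decide).comp (primrec_pI.comp hN) (Primrec.list_length.comp ?_)
    have h1 : Primrec fun q : ((ℕ × ℕ) × ℕ) × ℕ =>
        ((pS q.1.1.1, pT q.1.1.1), (q.1.2, Nat.pair q.2 q.1.1.2)) :=
      Primrec.pair (Primrec.pair (primrec_pS.comp hN) (primrec_pT.comp hN))
        (Primrec.pair hT (Primrec₂.natPair.comp Primrec.snd hw))
    have h2 : Primrec fun q : ((ℕ × ℕ) × ℕ) × ℕ =>
        hits c (pS q.1.1.1) (pT q.1.1.1) q.1.2 (Nat.pair q.2 q.1.1.2) :=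
      (primrec_hits c).comp h1
    exact h2

/-! ### binary values -/

def val (l : List Bool) : ℕ := l.foldr (fun b s => 2 * s + b.toNat) 0

theorem primrec_val : Primrec val := by
  refine Primrec.list_foldr (h := fun _ (p : Bool × ℕ) => 2 * p.2 + p.1.toNat)
    Primrec.id (Primrec.const 0) ?_
  refine Primrec.nat_add.comp (Primrec.nat_mul.comp (Primrec.const 2)
    (Primrec.snd.comp Primrec.snd)) ((Primrec.dom_finite Bool.toNat).comp
      (Primrec.fst.comp Primrec.snd))

theorem val_cons (a : Bool) (l : List Bool) : val (a :: l) = 2 * val l + a.toNat := rfl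

theorem val_append (l r : List Bool) : val (l ++ r) = val l + 2 ^ l.length * val r := by
  induction l with
  | nil => simp [val]
  | cons a l ih =>
    simp only [List.cons_append, val_cons, ih, List.length_cons, pow_succ]; ring

theorem val_lt (l : List Bool) : val l < 2 ^ l.length := by
  induction l with
  | nil => simp [val]
  | cons a l ih =>
    simp only [val_cons, List.length_cons, pow_succ]
    have := Bool.toNat_le a
    omega

theorem exists_val (b n : ℕ) (h : n < 2 ^ b) : ∃ l : List Bool, l.length = b ∧ val l = n := by
  induction b generalizing n with
  | zero => exact ⟨[], rfl, by simp at h; simp [h, val]⟩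
  | succ b ih =>
    obtain ⟨l, h1, h2⟩ := ih (n / 2) (by rw [pow_succ] at h; omega)
    refine ⟨decide (n % 2 = 1) :: l, by simp [h1], ?_⟩
    rw [val_cons, h2]
    by_cases h : n % 2 = 1 <;> simp [h] <;> omega

theorem val_inj (l r : List Bool) (h : l.length = r.length) (hv : val l = val r) : l = r := by
  induction l generalizing r with
  | nil => cases r <;> simp_all
  | cons a l ih =>
    cases r with
    | nil => simp at h
    | cons b r =>
      simp only [val_cons] at hv
      have h3 : a = b := by cases a <;> cases b <;> simp at hv ⊢ <;> omega
      subst h3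
      rw [ih r (by simpa using h) (by omega)]

/-- injective coding of lists of length at most `t` by numbers below `2^(t+1)` -/
theorem ncard_le (t : ℕ) (S : Set (List Bool)) (hS : ∀ p ∈ S, p.length ≤ t) :
    S.Finite ∧ S.ncard < 2 ^ (t + 1) := by
  let f : List Bool → ℕ := fun p => val (p ++ [true]) 
  have hf : ∀ p, f p = val p + 2 ^ p.length := fun p => by
    simp only [f]; rw [val_append]; simp [val]
  have inj : Function.Injective f := by
    intro p q h
    simp only [hf] at h
    have h1 := val_lt p
    have h2 := val_lt q
    have hl : p.length = q.length := by
      rcases lt_trichotomy p.length q.length with h3 | h3 | h3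
      · have := Nat.pow_le_pow_right (n := 2) (by norm_num) h3
        rw [pow_succ] at this; omega
      · exact h3
      · have := Nat.pow_le_pow_right (n := 2) (by norm_num) h3
        rw [pow_succ] at this; omega
    rw [hl] at h
    exact val_inj p q hl (by omega)
  have hmaps : f '' S ⊆ (Finset.Ico 1 (2 ^ (t + 1)) : Finset ℕ) := by
    rintro _ ⟨p, hp, rfl⟩
    have h1 := val_lt p
    have h2 := Nat.pow_le_pow_right (n := 2) (by norm_num) (hS p hp)
    have h3 : 0 < 2 ^ p.length := by positivity
    simp only [Finset.coe_Ico, Set.mem_Ico, hf, pow_succ]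
    omega
  have hfin : (f '' S).Finite := (Finset.finite_toSet _).subset hmaps
  refine ⟨hfin.of_finite_image inj.injOn, ?_⟩
  rw [← Set.ncard_image_of_injective S inj]
  have := Set.ncard_le_ncard hmaps (Finset.finite_toSet _)
  rw [Set.ncard_coe_finset, Nat.card_Ico] at this
  have : 0 < 2 ^ (t + 1) := by positivity
  omega

/-! ### the decoder -/

def pl (P : List Bool) : ℕ := P.idxOf false
def pN (P : List Bool) : ℕ := val P / 2 ^ (pl P + 1) % 2 ^ (pl P)
def pr (P : List Bool) : ℕ := val P / 2 ^ (2 * pl P + 1)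
def okP (P : List Bool) : Bool := decide (P.length = 2 * pl P + 1 + pB (pN P))

theorem primrec_pl : Primrec pl :=
  Primrec.list_idxOf.comp (Primrec.const false) Primrec.id
theorem primrec_pN : Primrec pN :=
  Primrec.nat_mod.comp (Primrec.nat_div.comp primrec_val
    (primrec_pow2.comp (Primrec.succ.comp primrec_pl))) (primrec_pow2.comp primrec_pl)
theorem primrec_tl : Primrec fun P => 2 * pl P + 1 :=
  Primrec.succ.comp (Primrec.nat_mul.comp (Primrec.const 2) primrec_pl)
theorem primrec_pr : Primrec pr :=
  Primrec.nat_div.comp primrec_val (primrec_pow2.comp primrec_tl)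
theorem primrec_okP : Primrec okP :=
  (Primrec.eq.decide).comp Primrec.list_length
    (Primrec.nat_add.comp primrec_tl (primrec_pB.comp primrec_pN))

def test (c : Code) (P : List Bool) (w T : ℕ) : Bool :=
  okP P && decide (2 ^ pB (pN P) ≤ (out c (pN P) w T).length)

def psi (c : Code) (P : List Bool) (w : ℕ) : Part ℕ :=
  (Nat.rfind fun T => Part.some (test c P w T)).map fun T => (out c (pN P) w T).getD (pr P) 0

theorem partrec_psi (c : Code) : Partrec₂ (psi c) := by
  have h1 : Primrec fun a : (List Bool × ℕ) × ℕ => ((pN a.1.1, a.1.2), a.2) :=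
    Primrec.pair (Primrec.pair
      (primrec_pN.comp (Primrec.fst.comp Primrec.fst)) (Primrec.snd.comp Primrec.fst)) Primrec.snd
  have hout : Primrec fun a : (List Bool × ℕ) × ℕ => out c (pN a.1.1) a.1.2 a.2 :=
    (primrec_out c).comp h1
  have htest : Primrec fun a : (List Bool × ℕ) × ℕ => test c a.1.1 a.1.2 a.2 := by
    unfold test
    refine Primrec.and.comp (primrec_okP.comp (Primrec.fst.comp Primrec.fst)) ?_
    exact (Primrec.nat_le.decide).comp
      (primrec_pow2.comp (primrec_pB.comp (primrec_pN.comp (Primrec.fst.comp Primrec.fst))))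
      (Primrec.list_length.comp hout)
  have h2 : Primrec fun a : (List Bool × ℕ) × ℕ => (out c (pN a.1.1) a.1.2 a.2).getD (pr a.1.1) 0 :=
    (Primrec.list_getD 0).comp hout (primrec_pr.comp (Primrec.fst.comp Primrec.fst))
  have h3 : Partrec fun a : List Bool × ℕ => Nat.rfind fun T => Part.some (test c a.1 a.2 T) :=
    Partrec.rfind (p := fun (a : List Bool × ℕ) T => Part.some (test c a.1 a.2 T))
      (htest.to_comp : Computable _).partrec
  exact Partrec.map h3 h2.to_comp

theorem psi_ok {c : Code} {P : List Bool} {w : ℕ} (h : (psi c P w).Dom) : okP P = true := by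
  obtain ⟨y, hy⟩ := Part.dom_iff_mem.1 h
  obtain ⟨T, hT, -⟩ := (Part.mem_map_iff _).1 hy
  have := Nat.rfind_spec hT
  simp only [Part.mem_some_iff, test] at this
  simp_all

theorem psi_prefixFree (c : Code) (y : ℕ) (p q : List Bool) (hpq : p <+: q)
    (hp : (psi c p y).Dom) (hq : (psi c q y).Dom) : p = q := by
  have hp := psi_ok hp
  have hq := psi_ok hq
  simp only [okP, decide_eq_true_eq] at hp hq
  obtain ⟨r, rfl⟩ := hpq
  have hl : pl (p ++ r) = pl p := by
    have : false ∈ p := by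
      rw [← List.idxOf_lt_length_iff]; unfold pl at hp; omega
    exact List.idxOf_append_of_mem this
  have hN : pN (p ++ r) = pN p := by
    unfold pN
    rw [hl, val_append]
    have : p.length = (pl p + 1) + (pl p + pB (pN p)) := by omega
    rw [this, pow_add, mul_assoc, Nat.add_mul_div_left _ _ (by positivity),
      pow_add 2 (pl p) (pB (pN p)), mul_assoc, Nat.add_mul_mod_self_left]
  rw [hl, hN] at hq
  have : (p ++ r).length = p.length := by omega
  have : r = [] := by simpa using this
  simp [this]

/-- A long description. -/
theorem exists_code_string (N r l : ℕ) (hN : N < 2 ^ l) (hr : r < 2 ^ pB N) :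
    ∃ P : List Bool, P.length = 2 * l + 1 + pB N ∧ okP P = true ∧ pN P = N ∧ pr P = r := by
  obtain ⟨u, hu, hu'⟩ := exists_val l N hN
  obtain ⟨v, hv, hv'⟩ := exists_val _ r hr
  let A : List Bool := List.replicate l true ++ [false]
  have hA : A.length = l + 1 := by simp [A]
  have hpl : pl (A ++ (u ++ v)) = l := by
    have h1 : false ∉ List.replicate l true := by simp [List.mem_replicate]
    simp only [pl, A, List.append_assoc]
    rw [List.idxOf_append_of_notMem h1]; simp
  have hval : val (A ++ (u ++ v)) = val A + 2 ^ (l + 1) * (N + 2 ^ l * r) := by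
    rw [val_append A, val_append u, hA, hu, hu', hv']
  have hAlt : val A < 2 ^ (l + 1) := hA ▸ val_lt A
  have hdiv : val (A ++ (u ++ v)) / 2 ^ (l + 1) = N + 2 ^ l * r := by
    rw [hval, Nat.add_mul_div_left _ _ (by positivity), Nat.div_eq_of_lt hAlt, zero_add]
  have hpN : pN (A ++ (u ++ v)) = N := by
    unfold pN
    rw [hpl, hdiv, Nat.add_mul_mod_self_left, Nat.mod_eq_of_lt hN]
  have hlen : (A ++ (u ++ v)).length = 2 * l + 1 + pB N := by
    simp only [List.length_append, hA, hu, hv]; omega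
  refine ⟨A ++ (u ++ v), hlen, ?_, hpN, ?_⟩
  · simp only [okP, decide_eq_true_eq, hlen, hpl, hpN]
  · unfold pr
    rw [hpl, show 2 * l + 1 = (l + 1) + l by ring, pow_add, ← Nat.div_div_eq_div_mul, hdiv,
      Nat.add_mul_div_left _ _ (by positivity), Nat.div_eq_of_lt hN, zero_add]


/-! ### semantics -/

def A (U : OptimalInterpreter) (s thr y : ℕ) : Set (List Bool) :=
  {p | p.length ≤ s ∧ ∃ k ∈ U.Φ p y, thr < k}

theorem A_finite (U : OptimalInterpreter) (s thr y : ℕ) : (A U s thr y).Finite :=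
  (ncard_le s _ fun _ hp => hp.1).1

def X (U : OptimalInterpreter) (N w : ℕ) : Set ℕ :=
  {x | len x = some (pM N) ∧ pI N ≤ (A U (pS N) (pT N) (Nat.pair x w)).ncard}

theorem encode_of_decode_bool {n : ℕ} {b : Bool} (h : decode (α := Bool) n = some b) :
    encode b = n := by
  match n with
  | 0 => simp at h; subst h; rfl
  | 1 => simp at h; subst h; rfl
  | n + 2 => rw [decode_ge_two (n + 2) (by omega)] at h; simp at h

theorem encode_of_decode {n : ℕ} {p : List Bool} (h : decode (α := List Bool) n = some p) :
    encode p = n := by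
  induction n using Nat.strong_induction_on generalizing p with
  | _ n ih =>
  match n, h, ih with
  | 0, h, _ => simp at h; subst h; rfl
  | v + 1, h, ih =>
    rw [Encodable.decode_list_succ] at h
    simp only [Seq.seq, Option.map_eq_map, Option.bind_eq_some_iff, Option.map_eq_some_iff] at h
    obtain ⟨f, ⟨a, ha, rfl⟩, l, hl, rfl⟩ := h
    rw [Encodable.encode_list_cons, encode_of_decode_bool ha,
      ih _ (Nat.lt_succ_of_le (Nat.unpair_right_le v)) hl, Nat.pair_unpair]

def IsCode (U : OptimalInterpreter) (c : Code) : Prop :=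
  ∀ n y k, k ∈ eval c (Nat.pair n y) ↔ ∃ p : List Bool, encode p = n ∧ k ∈ U.Φ p y

theorem exists_isCode (U : OptimalInterpreter) : ∃ c, IsCode U c := by
  obtain ⟨c, hc⟩ := exists_code.1 U.partrec
  refine ⟨c, fun n y k => ?_⟩
  rw [hc]
  simp only [Part.mem_bind_iff, Part.mem_ofOption, Part.mem_map_iff]
  constructor
  · rintro ⟨⟨p, y'⟩, h1, k', h2, rfl⟩
    simp only [Option.mem_def, decode_prod_val, Nat.unpair_pair, decode_nat, Option.map_some,
      Option.bind_eq_some_iff] at h1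
    obtain ⟨p', h3, h4⟩ := h1
    simp only [Option.some.injEq, Prod.mk.injEq] at h4
    obtain ⟨rfl, rfl⟩ := h4
    exact ⟨p', encode_of_decode h3, h2⟩
  · rintro ⟨p, rfl, h⟩
    refine ⟨(p, y), ?_, k, h, rfl⟩
    simp

theorem len_encode (p : List Bool) : len (encode p) = some p.length := by simp [len]

theorem mem_hits {c : Code} {s thr T y p : ℕ} : p ∈ hits c s thr T y ↔
    p < T ∧ (len p).getD 0 ≤ s ∧ ∃ k ∈ evaln T c (Nat.pair p y), thr < k := by
  unfold hits
  simp only [List.mem_filter, List.mem_range, Bool.and_eq_true, decide_eq_true_eq, Option.mem_def]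
  refine and_congr_right fun _ => and_congr_right fun _ => ?_
  cases evaln T c (Nat.pair p y) <;> simp

theorem hits_nodup (c : Code) (s thr T y : ℕ) : (hits c s thr T y).Nodup := by
  unfold hits
  exact List.nodup_range.filter _

theorem encode_injective : Function.Injective (encode : List Bool → ℕ) := Encodable.encode_injective

theorem hits_sound {U : OptimalInterpreter} {c : Code} (hc : IsCode U c) (s thr T y : ℕ) :
    (hits c s thr T y).length ≤ (A U s thr y).ncard := by
  rw [← List.toFinset_card_of_nodup (hits_nodup c s thr T y), ← Set.ncard_coe_finset,
    ← Set.ncard_image_of_injective (A U s thr y) encode_injective]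
  refine Set.ncard_le_ncard ?_ ((A_finite U s thr y).image _)
  intro p hp
  simp only [List.coe_toFinset, Set.mem_ofPred_eq, mem_hits] at hp
  obtain ⟨-, h2, k, hk, hlt⟩ := hp
  obtain ⟨q, rfl, hq⟩ := (hc _ _ _).1 (evaln_sound hk)
  rw [len_encode] at h2
  exact ⟨q, ⟨h2, k, hq, hlt⟩, rfl⟩

open Filter in
theorem hits_complete {U : OptimalInterpreter} {c : Code} (hc : IsCode U c) (s thr y : ℕ) :
    ∀ᶠ T in atTop, (A U s thr y).ncard ≤ (hits c s thr T y).length := by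
  have h1 : ∀ p ∈ A U s thr y, ∀ᶠ T in atTop, encode p ∈ hits c s thr T y := by
    rintro p ⟨hp, k, hk, hlt⟩
    obtain ⟨T, hT⟩ := evaln_complete.1 ((hc _ _ _).2 ⟨p, rfl, hk⟩)
    filter_upwards [eventually_ge_atTop T, eventually_gt_atTop (encode p)] with T' h1 h2
    rw [mem_hits, len_encode]
    exact ⟨h2, hp, k, evaln_mono h1 hT, hlt⟩
  filter_upwards [(eventually_all_finite (A_finite U s thr y)).2 h1] with T hT
  rw [← List.toFinset_card_of_nodup (hits_nodup c s thr T y), ← Set.ncard_coe_finset,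
    ← Set.ncard_image_of_injective (A U s thr y) encode_injective]
  refine Set.ncard_le_ncard ?_ (Finset.finite_toSet _)
  rintro _ ⟨p, hp, rfl⟩
  simpa using hT p hp

theorem mem_out {c : Code} {N w T x : ℕ} : x ∈ out c N w T ↔ x < T ∧ len x = some (pM N) ∧
    pI N ≤ (hits c (pS N) (pT N) T (Nat.pair x w)).length := by
  unfold out
  simp only [List.mem_filter, List.mem_range, Bool.and_eq_true, decide_eq_true_eq]

theorem out_nodup (c : Code) (N w T : ℕ) : (out c N w T).Nodup := by
  unfold out
  exact List.nodup_range.filter _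

theorem out_sound {U : OptimalInterpreter} {c : Code} (hc : IsCode U c) {N w T x : ℕ}
    (hx : x ∈ out c N w T) : x ∈ X U N w := by
  rw [mem_out] at hx
  exact ⟨hx.2.1, hx.2.2.trans (hits_sound hc _ _ _ _)⟩

open Filter in
theorem out_complete {U : OptimalInterpreter} {c : Code} (hc : IsCode U c) {N w : ℕ}
    (F : Finset ℕ) (hF : ∀ x ∈ F, x ∈ X U N w) : ∃ T, F.card ≤ (out c N w T).length := by
  have h1 : ∀ x ∈ F, ∀ᶠ T in atTop, x ∈ out c N w T := by
    intro x hx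
    filter_upwards [hits_complete hc (pS N) (pT N) (Nat.pair x w), eventually_gt_atTop x]
      with T h1 h2
    rw [mem_out]
    exact ⟨h2, (hF x hx).1, (hF x hx).2.trans h1⟩
  obtain ⟨T, hT⟩ := ((eventually_all_finset F).2 h1).exists
  refine ⟨T, ?_⟩
  rw [← List.toFinset_card_of_nodup (out_nodup c N w T)]
  exact Finset.card_le_card fun x hx => by simpa using hT x hx

theorem describe {U : OptimalInterpreter} {c : Code} (hc : IsCode U c) {N w l : ℕ}
    (hN : N < 2 ^ l) (F : Finset ℕ) (hF : ∀ x ∈ F, x ∈ X U N w) (hcard : 2 ^ pB N ≤ F.card) :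
    ∃ G : Finset ℕ, G.card = 2 ^ pB N ∧ ∀ x ∈ G, x ∈ X U N w ∧
      ∃ P : List Bool, P.length = 2 * l + 1 + pB N ∧ x ∈ psi c P w := by
  obtain ⟨T0, hT0⟩ := out_complete hc F hF
  obtain ⟨T, hT, -⟩ := Nat.rfind_min' (p := fun T => decide (2 ^ pB N ≤ (out c N w T).length))
    (m := T0) (by simpa using hcard.trans hT0)
  have hTl : 2 ^ pB N ≤ (out c N w T).length := by simpa using Nat.rfind_spec hT
  have hnd : ((out c N w T).take (2 ^ pB N)).Nodup := (out_nodup c N w T).sublist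
    (List.take_sublist _ _)
  refine ⟨((out c N w T).take (2 ^ pB N)).toFinset, ?_, ?_⟩
  · rw [List.toFinset_card_of_nodup hnd, List.length_take, min_eq_left hTl]
  · intro x hx
    rw [List.mem_toFinset] at hx
    refine ⟨out_sound hc (List.mem_of_mem_take hx), ?_⟩
    obtain ⟨r, hr, rfl⟩ := List.mem_take_iff_getElem.1 hx
    have hr1 : r < 2 ^ pB N := by omega
    obtain ⟨P, h1, h2, h3, h4⟩ := exists_code_string N r l hN hr1
    refine ⟨P, h1, ?_⟩
    unfold psi
    rw [Part.mem_map_iff]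
    refine ⟨T, ?_, ?_⟩
    · have : (fun T => Part.some (test c P w T)) =
          fun T => Part.some (decide (2 ^ pB N ≤ (out c N w T).length)) := by
        funext T; simp [test, h2, h3]
      rw [this]; exact hT
    · rw [h3, h4, List.getD_eq_getElem]

theorem K_le {U : OptimalInterpreter} {x y : ℕ} {p : List Bool} (h : x ∈ U.Φ p y) :
    U.K x y ≤ p.length := Nat.sInf_le ⟨p, rfl, h⟩

theorem K_spec (U : OptimalInterpreter) (x y : ℕ) :
    ∃ p : List Bool, p.length = U.K x y ∧ x ∈ U.Φ p y := by
  obtain ⟨p, hp⟩ := U.onto x y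
  exact Nat.sInf_mem (s := {n | ∃ p : List Bool, p.length = n ∧ x ∈ U.Φ p y}) ⟨_, p, rfl, hp⟩

theorem K_count (U : OptimalInterpreter) (w t : ℕ) (F : Finset ℕ) (hF : ∀ x ∈ F, U.K x w ≤ t) :
    F.card < 2 ^ (t + 1) := by
  choose f hf1 hf2 using fun x => K_spec U x w
  have inj : Function.Injective f := fun x y h => by
    have h1 := hf2 x
    rw [h] at h1
    exact Part.mem_unique h1 (hf2 y)
  have := (ncard_le t (f '' F) (by
    rintro _ ⟨x, hx, rfl⟩
    rw [hf1]; exact hF x hx)).2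
  rwa [Set.ncard_image_of_injective _ inj, Set.ncard_coe_finset] at this

theorem pair_lt {a b e : ℕ} (ha : a < 2 ^ e) (hb : b < 2 ^ e) : Nat.pair a b < 2 ^ (2 * e) := by
  refine (Nat.pair_lt_max_add_one_sq a b).trans_le ?_
  rw [mul_comm, pow_mul]
  exact Nat.pow_le_pow_left (max_lt ha hb) 2

theorem iterate_claim (U : OptimalInterpreter) {c : Code} (hc : IsCode U c) {d : ℕ}
    (hd : ∀ (x y : ℕ) (p : List Bool), x ∈ psi c p y →
        ∃ q : List Bool, x ∈ U.Φ q y ∧ q.length ≤ p.length + d)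
    (m w s e h g : ℕ) (hm : m < 2 ^ e) (hs : s < 2 ^ e) (hh : h = 16 * e + 1 + d)
    (hg : g = h + 2)
    (H : ∀ x, len x = some m → U.K (U.K x w) (Nat.pair x w) ≤ s) (i : ℕ)
    (hi : (i + 1) * g ≤ m) :
    ∃ F : Finset ℕ, 2 ^ (m - (i + 1) * g) ≤ F.card ∧ ∀ x ∈ F, len x = some m ∧
      i ≤ (A U s (m - (i + 1) * g + h) (Nat.pair x w)).ncard := by
  induction i with
  | zero =>
    let F : Finset ℕ := Finset.univ.image fun v : List.Vector Bool m => encode v.toList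
    refine ⟨F, ?_, ?_⟩
    · have : F.card = 2 ^ m := by
        rw [Finset.card_image_of_injective, Finset.card_univ, card_vector, Fintype.card_bool]
        intro u v huv
        exact List.Vector.eq _ _ (encode_injective huv)
      rw [this]
      exact Nat.pow_le_pow_right (by norm_num) (Nat.sub_le _ _)
    · intro x hx
      obtain ⟨v, -, rfl⟩ := Finset.mem_image.1 hx
      exact ⟨by rw [len_encode, v.toList_length], Nat.zero_le _⟩
  | succ i ih =>
    have e1 : (i + 1 + 1) * g = (i + 1) * g + g := by ring
    rw [e1] at hi ⊢
    obtain ⟨F, hFc, hF⟩ := ih (by omega)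
    have hg1 : i + 1 ≤ (i + 1) * g := Nat.le_mul_of_pos_right _ (by omega)
    have hg2 : g ≤ (i + 1) * g := Nat.le_mul_of_pos_left _ (by omega)
    generalize (i + 1) * g = q at *
    obtain ⟨b, hb⟩ : ∃ b, b = m - q := ⟨_, rfl⟩
    rw [← hb] at hFc hF
    let N := Nat.pair (Nat.pair i m) (Nat.pair (Nat.pair s (b + h)) b)
    have hNI : pI N = i := by simp [pI, N]
    have hNM : pM N = m := by simp [pM, N]
    have hNS : pS N = s := by simp [pS, N]
    have hNT : pT N = b + h := by simp [pT, N]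
    have hNB : pB N = b := by simp [pB, N]
    have hX : ∀ x, x ∈ X U N w ↔ len x = some m ∧ i ≤ (A U s (b + h) (Nat.pair x w)).ncard := by
      intro x
      simp only [X, Set.mem_ofPred_eq, hNI, hNM, hNS, hNT]
    have hNlt : N < 2 ^ (8 * e) := by
      have h1 : Nat.pair i m < 2 ^ (2 * e) := pair_lt (by omega) hm
      have h2 : Nat.pair s (b + h) < 2 ^ (2 * e) := pair_lt hs (by omega)
      have h3 : b < 2 ^ (2 * e) :=
        lt_of_lt_of_le (b := 2 ^ e) (by omega) (Nat.pow_le_pow_right (by norm_num) (by omega))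
      have h4 := pair_lt h2 h3
      have h5 : Nat.pair i m < 2 ^ (2 * (2 * e)) :=
        h1.trans_le (Nat.pow_le_pow_right (by norm_num) (by omega))
      have h6 := pair_lt h5 h4
      rwa [show 2 * (2 * (2 * e)) = 8 * e by ring] at h6
    obtain ⟨G, hGc, hG⟩ := describe hc hNlt F (fun x hx => (hX x).2 (hF x hx)) (by rwa [hNB])
    rw [hNB] at hGc hG
    have hGK : ∀ x ∈ G, U.K x w ≤ b + h := by
      intro x hx
      obtain ⟨-, P, hP, hxP⟩ := hG x hx
      obtain ⟨r, hr1, hr2⟩ := hd _ _ _ hxP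
      have := K_le hr1
      omega
    obtain ⟨t, ht⟩ : ∃ t, t = m - (q + g) + h := ⟨_, rfl⟩
    rw [← ht]
    have hbt : b = t + 1 + 1 := by omega
    have hlow := K_count U w t (G.filter fun x => U.K x w ≤ t) (by simp)
    have hsplit := Finset.card_filter_add_card_filter_not (s := G) (fun x => U.K x w ≤ t)
    have hpow : 2 ^ b = 2 * 2 ^ (t + 1) := by rw [hbt, pow_succ]; ring
    refine ⟨G.filter fun x => ¬ U.K x w ≤ t, ?_, ?_⟩
    · have : 2 ^ (m - (q + g)) ≤ 2 ^ (t + 1) := Nat.pow_le_pow_right (by norm_num) (by omega)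
      omega
    · intro x hx
      rw [Finset.mem_filter] at hx
      obtain ⟨hxG, hxt⟩ := hx
      have hxX := (hX x).1 (hG x hxG).1
      refine ⟨hxX.1, ?_⟩
      obtain ⟨p, hp1, hp2⟩ := K_spec U (U.K x w) (Nat.pair x w)
      have hps := H x hxX.1
      have hnot : p ∉ A U s (b + h) (Nat.pair x w) := by
        rintro ⟨-, k, hk, hlt⟩
        have := Part.mem_unique hk hp2
        have := hGK x hxG
        omega
      have hsub : insert p (A U s (b + h) (Nat.pair x w)) ⊆ A U s t (Nat.pair x w) := by
        rintro p' (rfl | ⟨h1, k, hk, hlt⟩)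
        · exact ⟨by omega, _, hp2, by omega⟩
        · exact ⟨h1, k, hk, by omega⟩
      have := Set.ncard_le_ncard hsub (A_finite _ _ _ _)
      rw [Set.ncard_insert_of_notMem hnot (A_finite _ _ _ _)] at this
      omega

theorem main (U : OptimalInterpreter) :
    ∃ C : ℕ, ∀ (m w : ℕ), ∃ x : List Bool, x.length = m ∧
      Nat.log 2 m ≤
        U.K (U.K (encode x) w) (Nat.pair (encode x) w) +
          Nat.log 2 (Nat.log 2 m) + C := by
  obtain ⟨c, hc⟩ := exists_isCode U
  obtain ⟨d, hd⟩ := U.optimal (psi c) (partrec_psi c) (psi_prefixFree c)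
  refine ⟨d + 20, fun m w => ?_⟩
  by_contra! hcon
  have hlog : Nat.log 2 (Nat.log 2 m) + (d + 20) < Nat.log 2 m := by
    have := hcon (List.replicate m true) (by simp)
    omega
  obtain ⟨n, hn⟩ : ∃ n, n = Nat.log 2 m := ⟨_, rfl⟩
  rw [← hn] at hcon hlog
  have hm0 : m ≠ 0 := by rintro rfl; simp at hn; omega
  have hmlo : 2 ^ n ≤ m := hn ▸ Nat.pow_log_le_self 2 hm0
  have hmhi : m < 2 ^ (n + 1) := hn ▸ Nat.lt_pow_succ_log_self (by norm_num) m
  have hnhi : n < 2 ^ (Nat.log 2 n + 1) := Nat.lt_pow_succ_log_self (by norm_num) n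
  generalize Nat.log 2 n = k at *
  obtain ⟨s, hs⟩ : ∃ s, s = n - k - (d + 20) - 1 := ⟨_, rfl⟩
  have H : ∀ x, len x = some m → U.K (U.K x w) (Nat.pair x w) ≤ s := by
    intro x hx
    simp only [len, Option.map_eq_some_iff] at hx
    obtain ⟨p, hp, hpm⟩ := hx
    have hpx : encode p = x := encode_of_decode hp
    have := hcon p hpm
    rw [hpx] at this
    omega
  have hs2 : s < 2 ^ (n + 1) := lt_of_le_of_lt (by omega) (Nat.lt_two_pow_self (n := n + 1))
  obtain ⟨h, hh⟩ : ∃ h, h = 16 * (n + 1) + 1 + d := ⟨_, rfl⟩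
  obtain ⟨g, hg⟩ : ∃ g, g = h + 2 := ⟨_, rfl⟩
  -- bound on g
  have hgub : g ≤ 2 ^ (d + 6 + k + 1) := by
    have h1 : 20 + d ≤ 2 ^ (d + 5) := by
      have := Nat.lt_two_pow_self (n := d)
      rw [pow_add]; omega
    have h2 : g ≤ (36 + d) * n := by nlinarith
    have h3 : 36 + d ≤ 2 ^ (d + 6) := by
      have := Nat.lt_two_pow_self (n := d)
      rw [pow_add]; omega
    calc g ≤ (36 + d) * n := h2
      _ ≤ 2 ^ (d + 6) * 2 ^ (k + 1) := Nat.mul_le_mul h3 hnhi.le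
      _ = _ := by rw [← pow_add]; rfl
  have hbig : 2 ^ (s + 2) * g ≤ m := by
    calc 2 ^ (s + 2) * g ≤ 2 ^ (s + 2) * 2 ^ (d + 6 + k + 1) := Nat.mul_le_mul_left _ hgub
      _ = 2 ^ (s + 2 + (d + 6 + k + 1)) := by rw [← pow_add]
      _ ≤ 2 ^ n := Nat.pow_le_pow_right (by norm_num) (by omega)
      _ ≤ m := hmlo
  have hi : (2 ^ (s + 1) + 1) * g ≤ m := by
    refine le_trans (Nat.mul_le_mul_right _ ?_) hbig
    have : 0 < 2 ^ (s + 1) := by positivity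
    rw [pow_succ 2 (s + 1)]; omega
  obtain ⟨F, hF1, hF2⟩ := iterate_claim U hc hd m w s (n + 1) h g hmhi hs2 hh hg H _ hi
  have hpos : 0 < F.card := lt_of_lt_of_le (by positivity) hF1
  obtain ⟨x, hx⟩ := Finset.card_pos.1 hpos
  have h1 := (hF2 x hx).2
  have h2 := (ncard_le s (A U s (m - (2 ^ (s + 1) + 1) * g + h) (Nat.pair x w))
    fun _ hp => hp.1).2
  omega

end HardStrings

/-- For every `m` and `w` there is a binary string `x` of length `m` with
`K(K(x|w) | x, w) ≥ log m − log log m − O(1)`. -/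
theorem complexity_of_complexity_hard_strings (U : OptimalInterpreter) :
    ∃ C : ℕ, ∀ (m w : ℕ), ∃ x : List Bool, x.length = m ∧
      Nat.log 2 m ≤
        U.K (U.K (encode x) w) (Nat.pair (encode x) w) +
          Nat.log 2 (Nat.log 2 m) + C := by
  exact HardStrings.main U
end

section
/- There exist a constant c > 0 and infinitely many n with a string x of length n such that K(x) + K(y|x) − K(x,y) ≥ log n − log log n − c, where y is the binary expansion of K(x). -/
open Encodable

namespace NonAdd

theorem K_le (U : OptimalInterpreter) {x y : ℕ} {p : List Bool} (h : x ∈ U.Φ p y) :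
    U.K x y ≤ p.length := Nat.sInf_le ⟨p, rfl, h⟩

theorem exists_prog (U : OptimalInterpreter) (x y : ℕ) :
    ∃ p : List Bool, p.length = U.K x y ∧ x ∈ U.Φ p y := by
  have : ({n | ∃ p : List Bool, p.length = n ∧ x ∈ U.Φ p y}).Nonempty := by
    obtain ⟨p, hp⟩ := U.onto x y
    exact ⟨_, p, rfl, hp⟩
  exact Nat.sInf_mem this

/-- `K(x, K(x)) ≤ K(x) + O(1)`. -/
theorem pair_le (U : OptimalInterpreter) :
    ∃ c : ℕ, ∀ x, U.Kp (Nat.pair x (U.Kp x)) ≤ U.Kp x + c := by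
  obtain ⟨c, hc⟩ := U.optimal (fun p y => (U.Φ p y).map (fun x => Nat.pair x p.length))
    (by
      refine Partrec.map (U.partrec) ?_
      exact (Primrec₂.natPair.to_comp.comp Computable.snd
        (Computable.list_length.comp (Computable.fst.comp Computable.fst))).to₂)
    (by
      intro y p q hpq hp hq
      exact U.prefixFree y p q hpq hp hq)
  refine ⟨c, fun x => ?_⟩
  obtain ⟨p, hl, hp⟩ := exists_prog U x 0
  obtain ⟨q, hq, hql⟩ := hc (Nat.pair x p.length) 0 p (Part.mem_map _ hp)
  rw [hl] at hq hql
  exact (K_le U hq).trans hql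

theorem count_computable {α : Type*} [Primcodable α] {f : α → ℕ → Bool} {h : α → ℕ}
    (hf : Computable₂ f) (hh : Computable h) :
    Computable fun a => Nat.count (fun i => f a i = true) (h a) := by
  have hs : Computable₂ fun (a : α) (q : ℕ × ℕ) => cond (f a q.1) (q.2 + 1) q.2 := by
    have h1 : Computable fun z : α × ℕ × ℕ => f z.1 z.2.1 :=
      hf.comp Computable.fst (Computable.fst.comp Computable.snd)
    have h2 : Computable fun z : α × ℕ × ℕ => z.2.2 := Computable.snd.comp Computable.snd
    have h3 : Computable fun z : α × ℕ × ℕ => z.2.2 + 1 := Computable.succ.comp h2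
    exact (Computable.cond h1 h3 h2).to₂
  refine (Computable.nat_rec hh (Computable.const 0) hs).of_eq fun a => ?_
  induction h a with
  | zero => simp
  | succ n ih =>
    rw [Nat.count_succ, ← ih]
    cases hfa : f a n <;> simp [hfa]

/-- value of the block of `len` bits of `p` starting at `a`. -/
def bv (p : List Bool) (a len : ℕ) : ℕ :=
  Nat.rec (motive := fun _ => ℕ) 0 (fun i acc => 2 * acc + cond (p.getD (a + i) false) 1 0) len

theorem bv_computable {α : Type*} [Primcodable α] {f : α → List Bool} {g h : α → ℕ}
    (hf : Computable f) (hg : Computable g) (hh : Computable h) :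
    Computable fun a => bv (f a) (g a) (h a) := by
  have hs : Computable₂ fun (a : α) (q : ℕ × ℕ) =>
      2 * q.2 + cond ((f a).getD (g a + q.1) false) 1 0 := by
    have h1 : Computable fun z : α × ℕ × ℕ => f z.1 := hf.comp Computable.fst
    have h2 : Computable fun z : α × ℕ × ℕ => g z.1 := hg.comp Computable.fst
    have h3 : Computable fun z : α × ℕ × ℕ => z.2.1 := Computable.fst.comp Computable.snd
    have h4 : Computable fun z : α × ℕ × ℕ => z.2.2 := Computable.snd.comp Computable.snd
    have h5 : Computable fun z : α × ℕ × ℕ => g z.1 + z.2.1 :=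
      Primrec.nat_add.to_comp.comp h2 h3
    have h6 : Computable fun z : α × ℕ × ℕ => (f z.1).getD (g z.1 + z.2.1) false :=
      (Primrec.list_getD false).to_comp.comp h1 h5
    have h7 : Computable fun z : α × ℕ × ℕ =>
        (cond ((f z.1).getD (g z.1 + z.2.1) false) 1 0 : ℕ) :=
      Computable.cond h6 (Computable.const 1) (Computable.const 0)
    have h8 : Computable fun z : α × ℕ × ℕ => 2 * z.2.2 :=
      Primrec.nat_mul.to_comp.comp (Computable.const 2) h4
    exact (Primrec.nat_add.to_comp.comp h8 h7 : Computable fun z : α × ℕ × ℕ =>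
      2 * z.2.2 + (cond ((f z.1).getD (g z.1 + z.2.1) false) 1 0 : ℕ)).to₂
  exact (Computable.nat_rec hh (Computable.const 0) hs).of_eq fun a => rfl

theorem bv_congr {p q : List Bool} {a len : ℕ}
    (h : ∀ i < len, p.getD (a + i) false = q.getD (a + i) false) : bv p a len = bv q a len := by
  induction len with
  | zero => rfl
  | succ n ih =>
    have h1 := ih fun i hi => h i (by omega)
    have h2 := h n (by omega)
    unfold bv at h1 ⊢
    simp only [h1, h2]

theorem getD_prefix {p q : List Bool} (h : p <+: q) {i : ℕ} (hi : i < p.length) :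
    p.getD i false = q.getD i false := by
  obtain ⟨s, rfl⟩ := h
  rw [List.getD_append _ _ _ _ hi]

theorem bv_prefix {p q : List Bool} (h : p <+: q) {a len : ℕ} (hl : a + len ≤ p.length) :
    bv p a len = bv q a len :=
  bv_congr fun i hi => getD_prefix h (by omega)

theorem exists_bits (len : ℕ) : ∀ v < 2 ^ len, ∃ w : List Bool, w.length = len ∧
    ∀ pre : List Bool, bv (pre ++ w) pre.length len = v := by
  induction len with
  | zero => intro v hv; exact ⟨[], rfl, fun pre => by simp at hv; simp [bv, hv]⟩
  | succ n ih =>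
    intro v hv
    obtain ⟨w, hw, hb⟩ := ih (v / 2) (by rw [pow_succ] at hv; omega)
    refine ⟨w ++ [decide (v % 2 = 1)], by simp [hw], fun pre => ?_⟩
    have h1 := hb pre
    have h2 : bv (pre ++ (w ++ [decide (v % 2 = 1)])) pre.length n = v / 2 := by
      rw [← h1]
      refine (bv_prefix ?_ (by simp [hw])).symm
      exact ⟨[decide (v % 2 = 1)], by simp⟩
    have h3 : (pre ++ (w ++ [decide (v % 2 = 1)])).getD (pre.length + n) false
        = decide (v % 2 = 1) := by
      rw [← List.append_assoc, List.getD_append_right _ _ _ _ (by simp [hw])]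
      simp [hw]
    unfold bv at h2 ⊢
    simp only [h2, h3]
    by_cases hv1 : v % 2 = 1 <;> simp [hv1] <;> omega

theorem idx_prefix {p q : List Bool} (h : p <+: q) (hl : p.idxOf false < p.length) :
    p.idxOf false = q.idxOf false := by
  obtain ⟨s, rfl⟩ := h
  rw [List.idxOf_append_of_mem (List.idxOf_lt_length_iff.1 hl)]

theorem idx_replicate (t : ℕ) (w : List Bool) :
    (List.replicate t true ++ false :: w).idxOf false = t := by
  rw [List.idxOf_append_of_notMem (by simp)]
  simp

/-- `e = ⟨x, s⟩` is counted when `s` is the first stage at which `x` is accepted. -/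
def firstHit (D : ℕ → ℕ → ℕ → Bool) (m e : ℕ) : Bool :=
  D m e.unpair.1 e.unpair.2 &&
    (Nat.count (fun i => D m e.unpair.1 i = true) e.unpair.2 == 0)

theorem fh1 : Computable fun z : ℕ × ℕ => z.2.unpair.1 :=
  Computable.fst.comp (Computable.unpair.comp Computable.snd)

theorem fh2 : Computable fun z : ℕ × ℕ => z.2.unpair.2 :=
  Computable.snd.comp (Computable.unpair.comp Computable.snd)

theorem fh3 {D : ℕ → ℕ → ℕ → Bool}
    (hD : Computable fun a : ℕ × ℕ × ℕ => D a.1 a.2.1 a.2.2) :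
    Computable fun z : ℕ × ℕ => D z.1 z.2.unpair.1 z.2.unpair.2 := by
  have h : Computable fun z : ℕ × ℕ => (z.1, z.2.unpair.1, z.2.unpair.2) :=
    Computable.fst.pair (fh1.pair fh2)
  exact hD.comp h

theorem fh4 {D : ℕ → ℕ → ℕ → Bool}
    (hD : Computable fun a : ℕ × ℕ × ℕ => D a.1 a.2.1 a.2.2) :
    Computable₂ fun (z : ℕ × ℕ) (i : ℕ) => D z.1 z.2.unpair.1 i := by
  have a1 : Computable fun w : (ℕ × ℕ) × ℕ => w.1.1 := Computable.fst.comp Computable.fst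
  have a2 : Computable fun w : (ℕ × ℕ) × ℕ => w.1.2.unpair.1 :=
    Computable.comp (f := fun z : ℕ × ℕ => z.2.unpair.1) (g := fun w : (ℕ × ℕ) × ℕ => w.1)
      fh1 Computable.fst
  have h : Computable fun w : (ℕ × ℕ) × ℕ => (w.1.1, w.1.2.unpair.1, w.2) :=
    a1.pair (a2.pair Computable.snd)
  have h2 : Computable fun w : (ℕ × ℕ) × ℕ => D w.1.1 w.1.2.unpair.1 w.2 :=
    Computable.comp (f := fun a : ℕ × ℕ × ℕ => D a.1 a.2.1 a.2.2)
      (g := fun w : (ℕ × ℕ) × ℕ => (w.1.1, w.1.2.unpair.1, w.2)) hD h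
  unfold Computable₂
  exact h2

theorem fh6 {D : ℕ → ℕ → ℕ → Bool}
    (hD : Computable fun a : ℕ × ℕ × ℕ => D a.1 a.2.1 a.2.2) :
    Computable fun z : ℕ × ℕ =>
      (Nat.count (fun i => D z.1 z.2.unpair.1 i = true) z.2.unpair.2 == 0) :=
  Primrec.beq.to_comp.comp (count_computable (fh4 hD) fh2) (Computable.const 0)

theorem firstHit_computable {D : ℕ → ℕ → ℕ → Bool}
    (hD : Computable fun a : ℕ × ℕ × ℕ => D a.1 a.2.1 a.2.2) : Computable₂ (firstHit D) := by
  have h7 : Computable fun z : ℕ × ℕ => firstHit D z.1 z.2 := by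
    unfold firstHit
    exact Primrec.and.to_comp.comp (fh3 hD) (fh6 hD)
  exact h7.to₂

theorem firstHit_iff {D : ℕ → ℕ → ℕ → Bool} {m e : ℕ} : firstHit D m e = true ↔
    D m e.unpair.1 e.unpair.2 = true ∧ ∀ i < e.unpair.2, ¬ D m e.unpair.1 i = true := by
  unfold firstHit
  rw [Bool.and_eq_true, beq_iff_eq, Nat.count_iff_forall_not]

/-- length of the leading block of ones -/
def hd (p : List Bool) : ℕ := p.idxOf false
/-- header number -/
def hm (p : List Bool) : ℕ := bv p (hd p + 1) (hd p)
/-- index -/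
def hi (p : List Bool) : ℕ := bv p (2 * hd p + 1) (hm p).unpair.1

/-- search predicate -/
def srch (D : ℕ → ℕ → ℕ → Bool) (p : List Bool) (e : ℕ) : Bool :=
  (p.length == 2 * hd p + 1 + (hm p).unpair.1) && (firstHit D (hm p).unpair.2 e &&
    (Nat.count (fun i => firstHit D (hm p).unpair.2 i = true) e == hi p))

theorem hd_computable : Computable hd :=
  (Primrec.list_idxOf.to_comp.comp (Computable.const false) Computable.id :
    Computable fun p : List Bool => p.idxOf false)

theorem hm_computable : Computable hm :=
  bv_computable Computable.id (Computable.succ.comp hd_computable) hd_computable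

theorem hdd_computable : Computable fun p => 2 * hd p + 1 :=
  Computable.succ.comp (Primrec.nat_mul.to_comp.comp (Computable.const 2) hd_computable)

theorem hr_computable : Computable fun p => (hm p).unpair.1 :=
  Computable.fst.comp (Computable.unpair.comp hm_computable)

theorem hm2_computable : Computable fun p => (hm p).unpair.2 :=
  Computable.snd.comp (Computable.unpair.comp hm_computable)

theorem hi_computable : Computable hi :=
  bv_computable Computable.id hdd_computable hr_computable

theorem srch_computable {D : ℕ → ℕ → ℕ → Bool}
    (hD : Computable fun a : ℕ × ℕ × ℕ => D a.1 a.2.1 a.2.2) : Computable₂ (srch D) := by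
  have hF := firstHit_computable hD
  have h1 : Computable fun p : List Bool => (p.length == 2 * hd p + 1 + (hm p).unpair.1) :=
    Primrec.beq.to_comp.comp Computable.list_length
      (Primrec.nat_add.to_comp.comp hdd_computable hr_computable)
  have h2 : Computable fun z : List Bool × ℕ => firstHit D (hm z.1).unpair.2 z.2 :=
    hF.comp (hm2_computable.comp Computable.fst) Computable.snd
  have h3 : Computable₂ fun (z : List Bool × ℕ) (i : ℕ) => firstHit D (hm z.1).unpair.2 i :=
    (hF.comp (hm2_computable.comp (Computable.fst.comp Computable.fst)) Computable.snd :
      Computable fun w : (List Bool × ℕ) × ℕ => firstHit D (hm w.1.1).unpair.2 w.2).to₂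
  have h4 := count_computable h3 Computable.snd
  have h5 : Computable fun z : List Bool × ℕ =>
      (Nat.count (fun i => firstHit D (hm z.1).unpair.2 i = true) z.2 == hi z.1) :=
    Primrec.beq.to_comp.comp h4 (hi_computable.comp Computable.fst)
  have h6 := Primrec.and.to_comp.comp h2 h5
  exact (Primrec.and.to_comp.comp (h1.comp Computable.fst) h6 :
    Computable fun z : List Bool × ℕ => srch D z.1 z.2).to₂

/-- the enumerating machine -/
def mach (D : ℕ → ℕ → ℕ → Bool) (p : List Bool) (_ : ℕ) : Part ℕ :=
  (Nat.rfind (fun e => (Part.some (srch D p e) : Part Bool))).map (fun e => e.unpair.1)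

theorem mach_partrec {D : ℕ → ℕ → ℕ → Bool}
    (hD : Computable fun a : ℕ × ℕ × ℕ => D a.1 a.2.1 a.2.2) : Partrec₂ (mach D) := by
  have h1 : Partrec fun p : List Bool =>
      Nat.rfind (fun e => (Part.some (srch D p e) : Part Bool)) :=
    Partrec.rfind (srch_computable hD).partrec₂
  have h2 : Partrec fun p : List Bool =>
      (Nat.rfind (fun e => (Part.some (srch D p e) : Part Bool))).map (fun e => e.unpair.1) :=
    h1.map (Computable.fst.comp (Computable.unpair.comp Computable.snd) :
      Computable fun z : List Bool × ℕ => z.2.unpair.1).to₂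
  exact (h2.comp Computable.fst : Partrec fun z : List Bool × ℕ => mach D z.1 z.2).to₂

theorem mach_dom {D : ℕ → ℕ → ℕ → Bool} {p : List Bool} {y : ℕ} (h : (mach D p y).Dom) :
    p.length = 2 * hd p + 1 + (hm p).unpair.1 := by
  have h1 : (Nat.rfind (fun e => (Part.some (srch D p e) : Part Bool))).Dom := h
  have h2 := Nat.rfind_spec (Part.get_mem h1)
  simp only [Part.mem_some_iff] at h2
  have h3 := h2.symm
  unfold srch at h3
  rw [Bool.and_eq_true, beq_iff_eq] at h3
  exact h3.1

theorem mach_prefixFree (D : ℕ → ℕ → ℕ → Bool) (y : ℕ) (p q : List Bool) (hpq : p <+: q)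
    (hp : (mach D p y).Dom) (hq : (mach D q y).Dom) : p = q := by
  have h1 := mach_dom hp
  have h2 := mach_dom hq
  have h3 : hd p = hd q := idx_prefix hpq (by unfold hd at h1; omega)
  have h4 : hm p = hm q := by
    unfold hm
    rw [← h3]
    exact bv_prefix hpq (by omega)
  exact hpq.eq_of_length (by rw [h1, h2, h3, h4])

theorem mach_mem {D : ℕ → ℕ → ℕ → Bool} {m r t i e y : ℕ} (hm' : Nat.pair r m < 2 ^ t)
    (hi' : i < 2 ^ r) (he : firstHit D m e = true)
    (hc : Nat.count (fun i => firstHit D m i = true) e = i) :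
    ∃ p : List Bool, p.length = 2 * t + 1 + r ∧ e.unpair.1 ∈ mach D p y := by
  obtain ⟨u, hu, hub⟩ := exists_bits t _ hm'
  obtain ⟨w, hw, hwb⟩ := exists_bits r _ hi'
  let p := List.replicate t true ++ false :: (u ++ w)
  have e1 : p = (List.replicate t true ++ [false]) ++ u ++ w := by simp [p]
  have hhd : hd p = t := idx_replicate t _
  have hhm : hm p = Nat.pair r m := by
    have := hub (List.replicate t true ++ [false])
    unfold hm
    rw [hhd, ← this, e1]
    simp only [List.length_append, List.length_replicate, List.length_singleton]
    refine (bv_prefix (List.prefix_append _ _) ?_).symm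
    simp [hu]; omega
  have hhi : hi p = i := by
    have := hwb (List.replicate t true ++ [false] ++ u)
    unfold hi
    rw [hhd, hhm, Nat.unpair_pair, ← this, e1]
    congr 1
    simp [hu]; omega
  have hlen : p.length = 2 * t + 1 + r := by
    simp [p, hu, hw]; omega
  have hs : ∀ e', srch D p e' = true ↔ e' = e := by
    intro e'
    unfold srch
    rw [Bool.and_eq_true, Bool.and_eq_true, beq_iff_eq, beq_iff_eq, hhd, hhm, hhi,
      Nat.unpair_pair]
    constructor
    · rintro ⟨_, h1, h2⟩
      exact Nat.count_injective h1 he (h2.trans hc.symm)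
    · rintro rfl
      exact ⟨hlen, he, hc⟩
  refine ⟨p, hlen, ?_⟩
  obtain ⟨n, hn, _⟩ := Nat.rfind_min' (p := fun e => srch D p e) ((hs e).2 rfl)
  have h2 := Nat.rfind_spec hn
  have h3 : n = e := (hs n).1 (Part.mem_some_iff.1 h2).symm
  subst h3
  exact Part.mem_map _ hn

/-- Main enumeration lemma. -/
theorem enum_lemma (U : OptimalInterpreter) (D : ℕ → ℕ → ℕ → Bool)
    (hD : Computable fun a : ℕ × ℕ × ℕ => D a.1 a.2.1 a.2.2) :
    ∃ C : ℕ, ∀ m r t : ℕ, Nat.pair r m < 2 ^ t → ∀ F : Finset ℕ, (∀ x ∈ F, ∃ s, D m x s = true) →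
      2 ^ r ≤ F.card → ∃ T : Finset ℕ, (∀ x ∈ T, ∃ s, D m x s = true) ∧ T.card = 2 ^ r ∧
        ∀ x ∈ T, U.Kp x ≤ r + 2 * t + C := by
  obtain ⟨c, hc⟩ := U.optimal (mach D) (mach_partrec hD) (mach_prefixFree D)
  refine ⟨c + 1, fun m r t hm' F hF hcard => ?_⟩
  let P : ℕ → Prop := fun e => firstHit D m e = true
  have hcardP : ∀ hf : (Set.ofPred P).Finite, F.card ≤ hf.toFinset.card := by
    intro hf
    classical
    choose! g hg using hF
    let g' : ℕ → ℕ := fun x => if h : ∃ s, D m x s = true then Nat.find h else 0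
    refine Finset.card_le_card_of_injOn (fun x => Nat.pair x (g' x)) ?_ ?_
    · intro x hx
      have hx' : ∃ s, D m x s = true := ⟨_, hg x hx⟩
      have : P (Nat.pair x (g' x)) := by
        refine firstHit_iff.2 ?_
        simp only [Nat.unpair_pair, g', dif_pos hx']
        exact ⟨Nat.find_spec hx', fun i hi => Nat.find_min hx' hi⟩
      simpa using! this
    · intro x _ y _ hxy
      exact (Nat.pair_eq_pair.1 hxy).1
  have hlt : ∀ i < 2 ^ r, ∀ hf : (Set.ofPred P).Finite, i < hf.toFinset.card :=
    fun i hi hf => hi.trans_le (hcard.trans (hcardP hf))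
  refine ⟨(Finset.range (2 ^ r)).image (fun i => (Nat.nth P i).unpair.1), ?_, ?_, ?_⟩
  · intro x hx
    obtain ⟨i, hi, rfl⟩ := Finset.mem_image.1 hx
    have := Nat.nth_mem i (hlt i (Finset.mem_range.1 hi))
    exact ⟨_, (firstHit_iff.1 this).1⟩
  · rw [Finset.card_image_of_injOn, Finset.card_range]
    intro i hi j hj hij
    have hi1 := hlt i (by simpa using hi)
    have hj1 := hlt j (by simpa using hj)
    have hi2 := firstHit_iff.1 (Nat.nth_mem i hi1)
    have hj2 := firstHit_iff.1 (Nat.nth_mem j hj1)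
    simp only at hij
    rw [hij] at hi2
    have h2 : (Nat.nth P i).unpair.2 = (Nat.nth P j).unpair.2 := by
      rcases lt_trichotomy (Nat.nth P i).unpair.2 (Nat.nth P j).unpair.2 with h | h | h
      · exact absurd hi2.1 (hj2.2 _ h)
      · exact h
      · exact absurd hj2.1 (hi2.2 _ h)
    have h3 : Nat.nth P i = Nat.nth P j := by
      rw [← Nat.pair_unpair (Nat.nth P i), hij, h2, Nat.pair_unpair]
    rw [← Nat.count_nth hi1, ← Nat.count_nth hj1, h3]
  · intro x hx
    obtain ⟨i, hi, rfl⟩ := Finset.mem_image.1 hx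
    have hi0 := Finset.mem_range.1 hi
    have hi1 := hlt i hi0
    obtain ⟨p, hpl, hp⟩ := mach_mem (y := 0) hm' hi0 (Nat.nth_mem i hi1) (Nat.count_nth hi1)
    obtain ⟨q, hq, hql⟩ := hc _ _ _ hp
    have := K_le U hq
    unfold OptimalInterpreter.Kp
    omega

open Nat.Partrec (Code)

theorem exists_code' (U : OptimalInterpreter) : ∃ c : Code, ∀ (p : List Bool) (y v : ℕ),
    v ∈ U.Φ p y ↔ ∃ t, v ∈ Code.evaln t c (Nat.pair (encode p) y) := by
  have h : Partrec fun z : List Bool × ℕ => U.Φ z.1 z.2 := U.partrec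
  obtain ⟨c, hc⟩ := Code.exists_code.1 h
  refine ⟨c, fun p y v => ?_⟩
  rw [← Code.evaln_complete, hc]
  simp

/-- decode a list, with default -/
def lst (x : ℕ) : List Bool := (decode (α := List Bool) x).getD []

theorem lst_encode (l : List Bool) : lst (encode l) = l := by simp [lst]

theorem lst_computable : Computable lst := by
  have : Primrec lst := Primrec.option_getD.comp Primrec.decode (Primrec.const [])
  exact this.to_comp

/-- one candidate program `q` -/
def okp (c : Code) (k y t v q : ℕ) : Bool :=
  (encode (lst q) == q) && (decide ((lst q).length ≤ k) &&
    decide (Code.evaln t c (Nat.pair q y) = some v))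

/-- `v` has been found by stage `t` as an output of a program of length at most `k`
with condition `y` -/
def hit (c : Code) (k y t v : ℕ) : Bool :=
  decide (1 ≤ Nat.count (fun q => okp c k y t v q = true) t)

/-- number of values found by stage `t` -/
def nhits (c : Code) (k y r t : ℕ) : ℕ :=
  Nat.count (fun v => (decide (r ≤ v) && hit c k y t v) = true) t

/-- the decidable approximation -/
def DD (c : Code) (m x t : ℕ) : Bool :=
  (encode (lst x) == x) && (((lst x).length == m.unpair.1) &&
    decide (m.unpair.2.unpair.2.unpair.1 ≤
      nhits c m.unpair.2.unpair.1 x m.unpair.2.unpair.2.unpair.2 t))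

theorem le_computable {α : Type*} [Primcodable α] {f g : α → ℕ} (hf : Computable f)
    (hg : Computable g) : Computable fun a => decide (f a ≤ g a) :=
  Computable₂.comp (f := fun a b : ℕ => decide (a ≤ b)) Primrec.nat_le.decide.to_comp hf hg

theorem and_computable {α : Type*} [Primcodable α] {f g : α → Bool} (hf : Computable f)
    (hg : Computable g) : Computable fun a => (f a && g a) :=
  Computable₂.comp (f := fun a b : Bool => (a && b)) Primrec.and.to_comp hf hg

theorem eq_computable {α β : Type*} [Primcodable α] [Primcodable β] [DecidableEq β] {f g : α → β}
    (hf : Computable f) (hg : Computable g) : Computable fun a => (f a == g a) :=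
  Computable₂.comp (f := fun a b : β => (a == b)) Primrec.beq.to_comp hf hg

theorem deq_computable {α β : Type*} [Primcodable α] [Primcodable β] [DecidableEq β] {f g : α → β}
    (hf : Computable f) (hg : Computable g) : Computable fun a => decide (f a = g a) :=
  Computable₂.comp (f := fun a b : β => decide (a = b)) Primrec.eq.decide.to_comp hf hg

theorem enc_computable {α : Type*} [Primcodable α] {f : α → ℕ} (hf : Computable f) :
    Computable fun a => (encode (lst (f a)) == f a) :=
  eq_computable (Computable.comp (f := fun l : List Bool => encode l)
    (g := fun a => lst (f a)) Computable.encode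
    (Computable.comp (f := lst) (g := f) lst_computable hf)) hf

theorem len_computable {α : Type*} [Primcodable α] {f : α → ℕ} (hf : Computable f) :
    Computable fun a => (lst (f a)).length :=
  Computable.comp (f := fun l : List Bool => l.length)
    (g := fun a => lst (f a)) Computable.list_length
    (Computable.comp (f := lst) (g := f) lst_computable hf)

theorem okp_computable {α : Type*} [Primcodable α] (c : Code) {k y t v q : α → ℕ}
    (hk : Computable k) (hy : Computable y) (ht : Computable t) (hv : Computable v)
    (hq : Computable q) : Computable fun a => okp c (k a) (y a) (t a) (v a) (q a) := by
  have h1 : Computable fun a => Nat.pair (q a) (y a) :=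
    Computable₂.comp (f := Nat.pair) Primrec₂.natPair.to_comp hq hy
  have h2 : Computable fun a => Code.evaln (t a) c (Nat.pair (q a) (y a)) :=
    Computable.comp (f := fun a : (ℕ × Code) × ℕ => Code.evaln a.1.1 a.1.2 a.2)
      (g := fun a => ((t a, c), Nat.pair (q a) (y a)))
      Code.primrec_evaln.to_comp ((ht.pair (Computable.const c)).pair h1)
  have h3 : Computable fun a => some (v a) := Computable.option_some.comp hv
  exact and_computable (enc_computable hq) (and_computable (le_computable (len_computable hq) hk)
    (deq_computable h2 h3))

theorem hit_computable {α : Type*} [Primcodable α] (c : Code) {k y t v : α → ℕ}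
    (hk : Computable k) (hy : Computable y) (ht : Computable t) (hv : Computable v) :
    Computable fun a => hit c (k a) (y a) (t a) (v a) := by
  have h1 : Computable fun z : α × ℕ => okp c (k z.1) (y z.1) (t z.1) (v z.1) z.2 :=
    okp_computable c (hk.comp Computable.fst) (hy.comp Computable.fst) (ht.comp Computable.fst)
      (hv.comp Computable.fst) Computable.snd
  exact le_computable (Computable.const 1)
    (count_computable (f := fun a q => okp c (k a) (y a) (t a) (v a) q) h1 ht)

theorem nhits_computable {α : Type*} [Primcodable α] (c : Code) {k y r t : α → ℕ}
    (hk : Computable k) (hy : Computable y) (hr : Computable r) (ht : Computable t) :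
    Computable fun a => nhits c (k a) (y a) (r a) (t a) := by
  have h1 : Computable fun z : α × ℕ =>
      (decide (r z.1 ≤ z.2) && hit c (k z.1) (y z.1) (t z.1) z.2) :=
    and_computable (le_computable (hr.comp Computable.fst) Computable.snd)
      (hit_computable c (hk.comp Computable.fst) (hy.comp Computable.fst)
        (ht.comp Computable.fst) Computable.snd)
  exact count_computable (f := fun a v => (decide (r a ≤ v) && hit c (k a) (y a) (t a) v)) h1 ht

theorem u1_computable {α : Type*} [Primcodable α] {f : α → ℕ} (hf : Computable f) :
    Computable fun a => (f a).unpair.1 :=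
  Computable.comp (f := fun n : ℕ => n.unpair.1) (g := f)
    (Computable.fst.comp Computable.unpair) hf

theorem u2_computable {α : Type*} [Primcodable α] {f : α → ℕ} (hf : Computable f) :
    Computable fun a => (f a).unpair.2 :=
  Computable.comp (f := fun n : ℕ => n.unpair.2) (g := f)
    (Computable.snd.comp Computable.unpair) hf

theorem DD_computable (c : Code) : Computable fun a : ℕ × ℕ × ℕ => DD c a.1 a.2.1 a.2.2 := by
  have hm : Computable fun a : ℕ × ℕ × ℕ => a.1 := Computable.fst
  have hx : Computable fun a : ℕ × ℕ × ℕ => a.2.1 := Computable.fst.comp Computable.snd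
  have ht : Computable fun a : ℕ × ℕ × ℕ => a.2.2 := Computable.snd.comp Computable.snd
  have h2 := u2_computable hm
  have h22 := u2_computable h2
  exact and_computable (enc_computable hx) (and_computable
    (eq_computable (len_computable hx) (u1_computable hm))
    (le_computable (u1_computable h22)
      (nhits_computable c (u1_computable h2) hx (u2_computable h22) ht)))

/-- `v` is an output of a program of length at most `k` with condition `y` -/
def Cand (U : OptimalInterpreter) (k y v : ℕ) : Prop :=
  ∃ p : List Bool, p.length ≤ k ∧ v ∈ U.Φ p y

theorem hit_sound {U : OptimalInterpreter} {c : Code}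
    (hc : ∀ (p : List Bool) (y v : ℕ),
      v ∈ U.Φ p y ↔ ∃ t, v ∈ Code.evaln t c (Nat.pair (encode p) y))
    {k y t v : ℕ} (h : hit c k y t v = true) : Cand U k y v := by
  unfold hit at h
  have h1 := of_decide_eq_true h
  obtain ⟨q, _, hq⟩ := Nat.count_ne_iff_exists.1 (Nat.one_le_iff_ne_zero.1 h1)
  unfold okp at hq
  simp only [Bool.and_eq_true, beq_iff_eq, decide_eq_true_eq] at hq
  exact ⟨lst q, hq.2.1, (hc _ _ _).2 ⟨t, by rw [hq.1]; exact hq.2.2⟩⟩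

theorem hit_complete {U : OptimalInterpreter} {c : Code}
    (hc : ∀ (p : List Bool) (y v : ℕ),
      v ∈ U.Φ p y ↔ ∃ t, v ∈ Code.evaln t c (Nat.pair (encode p) y))
    {k y v : ℕ} (h : Cand U k y v) : ∃ t0, ∀ t ≥ t0, hit c k y t v = true := by
  obtain ⟨p, hp, hv⟩ := h
  obtain ⟨t1, ht1⟩ := (hc _ _ _).1 hv
  refine ⟨max t1 (encode p + 1), fun t ht => ?_⟩
  unfold hit
  refine decide_eq_true (Nat.one_le_iff_ne_zero.2 (Nat.count_ne_iff_exists.2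
    ⟨encode p, by omega, ?_⟩))
  unfold okp
  simp only [Bool.and_eq_true, beq_iff_eq, decide_eq_true_eq, lst_encode]
  exact ⟨trivial, hp, Code.evaln_mono (by omega) ht1⟩

theorem exists_D (U : OptimalInterpreter) : ∃ D : ℕ → ℕ → ℕ → Bool,
    (Computable fun a : ℕ × ℕ × ℕ => D a.1 a.2.1 a.2.2) ∧
    ∀ n k s r x, (∃ t, D (Nat.pair n (Nat.pair k (Nat.pair s r))) x t = true) ↔
      ∃ l : List Bool, encode l = x ∧ l.length = n ∧ ∃ V : Finset ℕ, s ≤ V.card ∧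
        ∀ v ∈ V, r ≤ v ∧ Cand U k x v := by
  obtain ⟨c, hc⟩ := exists_code' U
  refine ⟨DD c, DD_computable c, fun n k s r x => ?_⟩
  have hDD : ∀ t, DD c (Nat.pair n (Nat.pair k (Nat.pair s r))) x t = true ↔
      encode (lst x) = x ∧ (lst x).length = n ∧ s ≤ nhits c k x r t := by
    intro t
    unfold DD
    simp only [Nat.unpair_pair, Bool.and_eq_true, beq_iff_eq, decide_eq_true_eq]
  simp only [hDD]
  constructor
  · rintro ⟨t, h1, h2, h3⟩
    refine ⟨lst x, h1, h2,
      (Finset.range t).filter fun v => (decide (r ≤ v) && hit c k x t v) = true, ?_, ?_⟩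
    · rw [← Nat.count_eq_card_filter_range]
      exact h3
    · intro v hv
      have := (Finset.mem_filter.1 hv).2
      simp only [Bool.and_eq_true, decide_eq_true_eq] at this
      exact ⟨this.1, hit_sound hc this.2⟩
  · rintro ⟨l, rfl, hl, V, hV, h⟩
    rw [lst_encode]
    choose! t0 ht0 using fun v hv => hit_complete hc (h v hv).2
    refine ⟨V.sup t0 + V.sup id + 1, rfl, hl, hV.trans ?_⟩
    unfold nhits
    rw [Nat.count_eq_card_filter_range]
    refine Finset.card_le_card fun v hv => ?_
    have h1 : t0 v ≤ V.sup t0 := Finset.le_sup hv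
    have h2 : v ≤ V.sup id := Finset.le_sup (f := id) hv
    rw [Finset.mem_filter, Finset.mem_range]
    refine ⟨by omega, ?_⟩
    simp only [Bool.and_eq_true, decide_eq_true_eq]
    exact ⟨(h v hv).1, ht0 v hv _ (by omega)⟩

/-- number of strings of length less than `k` -/
theorem card_short (k : ℕ) (S : Finset (List Bool)) (hS : ∀ p ∈ S, p.length < k) :
    S.card + 1 ≤ 2 ^ k := by
  induction k generalizing S with
  | zero =>
    have : S = ∅ := Finset.eq_empty_of_forall_notMem fun p hp => by simpa using hS p hp
    simp [this]
  | succ k ih =>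
    have h1 := ih (S.filter fun p => p.length < k) (fun p hp => (Finset.mem_filter.1 hp).2)
    have h2 : (S.filter fun p => ¬ p.length < k).card ≤ 2 ^ k := by
      have : (Finset.univ : Finset (List.Vector Bool k)).card = 2 ^ k := by simp
      rw [← this, ← Finset.card_image_of_injective (f := fun v : List.Vector Bool k => v.1)
        Finset.univ Subtype.val_injective]
      refine Finset.card_le_card fun p hp => ?_
      have hp' := Finset.mem_filter.1 hp
      have := hS p hp'.1
      exact Finset.mem_image.2 ⟨⟨p, by omega⟩, Finset.mem_univ _, rfl⟩
    have h3 := Finset.card_filter_add_card_filter_not (s := S) (fun p => p.length < k)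
    rw [pow_succ]
    omega

/-- few numbers have small complexity -/
theorem card_low (U : OptimalInterpreter) (k y : ℕ) (S : Finset ℕ)
    (hS : ∀ v ∈ S, ∃ p : List Bool, p.length < k ∧ v ∈ U.Φ p y) : S.card + 1 ≤ 2 ^ k := by
  choose! f hf using hS
  have : (S.image f).card = S.card := by
    refine Finset.card_image_of_injOn fun a ha b hb hab => ?_
    have h1 := (hf a ha).2
    have h2 := (hf b hb).2
    rw [hab] at h1
    exact Part.mem_unique h1 h2
  rw [← this]
  refine card_short k _ fun p hp => ?_
  obtain ⟨v, hv, rfl⟩ := Finset.mem_image.1 hp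
  exact (hf v hv).1

theorem pair_lt {a b l : ℕ} (ha : a < 2 ^ l) (hb : b < 2 ^ l) : Nat.pair a b < 2 ^ (2 * l) := by
  have h1 := Nat.pair_lt_max_add_one_sq a b
  have h2 : max a b + 1 ≤ 2 ^ l := by omega
  calc Nat.pair a b < (max a b + 1) ^ 2 := h1
    _ ≤ (2 ^ l) ^ 2 := Nat.pow_le_pow_left h2 2
    _ = 2 ^ (2 * l) := by rw [← pow_mul, mul_comm]

theorem params_lt {r' n k s r l : ℕ} (h0 : r' < 2 ^ l) (h1 : n < 2 ^ l) (h2 : k < 2 ^ l)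
    (h3 : s < 2 ^ l) (h4 : r < 2 ^ l) :
    Nat.pair r' (Nat.pair n (Nat.pair k (Nat.pair s r))) < 2 ^ (16 * l) := by
  have up : ∀ {a i j : ℕ}, a < 2 ^ i → i ≤ j → a < 2 ^ j :=
    fun h hij => h.trans_le (Nat.pow_le_pow_right (by norm_num) hij)
  have a1 := pair_lt h3 h4
  have a2 := pair_lt (up h2 (by omega : l ≤ 2 * l)) a1
  have a3 := pair_lt (up h1 (by omega : l ≤ 2 * (2 * l))) a2
  have a4 := pair_lt (up h0 (by omega : l ≤ 2 * (2 * (2 * l)))) a3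
  exact up a4 (by omega)

/-- Gács: counting form. -/
theorem gacs_count (U : OptimalInterpreter) : ∃ C : ℕ, ∀ n k : ℕ, k ≤ n →
    (∀ x : List Bool, x.length = n → U.K (U.Kp (encode x)) (encode x) ≤ k) →
    n < 2 ^ (k + 1) * (32 * (Nat.log 2 n + 1) + C) := by
  obtain ⟨D, hD, hDs⟩ := exists_D U
  obtain ⟨C, hC⟩ := enum_lemma U D hD
  refine ⟨C + 2, fun n k hkn hK => ?_⟩
  set l := Nat.log 2 n + 1 with hl
  have hnl : n < 2 ^ l := Nat.lt_pow_succ_log_self (by norm_num) n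
  set L := 32 * l + (C + 2) with hL
  have key : ∀ s, s * L ≤ n → ∃ F : Finset ℕ, 2 ^ (n - s * L) ≤ F.card ∧
      ∀ x ∈ F, ∃ t, D (Nat.pair n (Nat.pair k (Nat.pair s (n - s * L)))) x t = true := by
    intro s
    induction s with
    | zero =>
      intro _
      refine ⟨(Finset.univ : Finset (List.Vector Bool n)).image (fun v => encode v.1), ?_, ?_⟩
      · rw [Finset.card_image_of_injective]
        · simp
        · intro a b hab
          exact Subtype.ext (Encodable.encode_injective hab)
      · intro x hx
        obtain ⟨v, _, rfl⟩ := Finset.mem_image.1 hx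
        exact (hDs _ _ _ _ _).2 ⟨v.1, rfl, v.2, ∅, by simp, by simp⟩
    | succ s ih =>
      intro hs
      rw [Nat.succ_mul] at hs
      obtain ⟨F, hFc, hF⟩ := ih (by omega)
      set r := n - s * L with hr
      have hr1 : n - (s + 1) * L = r - L := by rw [Nat.succ_mul]; omega
      rw [hr1]
      have hLr : L ≤ r := by omega
      have hsn : s ≤ n := by
        have : s * 1 ≤ s * L := Nat.mul_le_mul_left s (by omega)
        omega
      obtain ⟨T, hT, hTc, hTK⟩ := hC (Nat.pair n (Nat.pair k (Nat.pair s r))) (r - L + 1) (16 * l)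
        (params_lt (by omega) hnl (by omega) (by omega) (by omega)) F hF
        ((Nat.pow_le_pow_right (by norm_num) (by omega)).trans hFc)
      refine ⟨T.filter fun x => ¬ U.Kp x < r - L, ?_, ?_⟩
      · have h1 : (T.filter fun x => U.Kp x < r - L).card + 1 ≤ 2 ^ (r - L) := by
          refine card_low U _ 0 _ fun x hx => ?_
          obtain ⟨p, hp, hx'⟩ := exists_prog U x 0
          exact ⟨p, hp ▸ (Finset.mem_filter.1 hx).2, hx'⟩
        have h3 := Finset.card_filter_add_card_filter_not (s := T) (fun x => U.Kp x < r - L)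
        rw [hTc, pow_succ] at h3
        omega
      · intro x hx
        obtain ⟨hxT, hxK⟩ := Finset.mem_filter.1 hx
        obtain ⟨w, hw, hwn, V, hVc, hV⟩ := (hDs _ _ _ _ _).1 (hT x hxT)
        have hlt := hTK x hxT
        refine (hDs _ _ _ _ _).2 ⟨w, hw, hwn, insert (U.Kp x) V, ?_, ?_⟩
        · rw [Finset.card_insert_of_notMem]
          · omega
          · intro hmem
            have := (hV _ hmem).1
            omega
        · intro v hv
          rcases Finset.mem_insert.1 hv with rfl | hv
          · refine ⟨by omega, ?_⟩
            obtain ⟨p, hp, hx'⟩ := exists_prog U (U.Kp x) x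
            refine ⟨p, ?_, hx'⟩
            have := hK w hwn
            rw [hw] at this
            omega
          · exact ⟨by have := (hV v hv).1; omega, (hV v hv).2⟩
  obtain ⟨F, hFc, hF⟩ := key (n / L) (Nat.div_mul_le_self n L)
  have hne : F.Nonempty := by
    rw [← Finset.card_pos]
    exact lt_of_lt_of_le (by positivity) hFc
  obtain ⟨x, hx⟩ := hne
  obtain ⟨w, hw, hwn, V, hVc, hV⟩ := (hDs _ _ _ _ _).1 (hF x hx)
  have h1 : V.card + 1 ≤ 2 ^ (k + 1) := card_low U (k + 1) x V fun v hv => by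
    obtain ⟨p, hp, h⟩ := (hV v hv).2
    exact ⟨p, by omega, h⟩
  have h2 : n / L < 2 ^ (k + 1) := by omega
  exact (Nat.div_lt_iff_lt_mul (by omega)).1 h2

/-- Theorem of Gács. -/
theorem gacs (U : OptimalInterpreter) : ∃ c : ℕ, ∀ n : ℕ, 2 ≤ n → ∃ x : List Bool, x.length = n ∧
    Nat.log 2 n ≤ U.K (U.Kp (encode x)) (encode x) + Nat.log 2 (Nat.log 2 n) + c := by
  obtain ⟨C, hC⟩ := gacs_count U
  refine ⟨2 * (64 + C), fun n hn => ?_⟩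
  by_contra hcon
  push Not at hcon
  set a := Nat.log 2 n with ha
  set b := Nat.log 2 a with hb
  have ha1 : 1 ≤ a := Nat.log_pos (by norm_num) hn
  have hab : b + 2 * (64 + C) < a := by
    have := hcon (List.replicate n true) (by simp)
    omega
  have han : 2 ^ a ≤ n := Nat.pow_log_le_self 2 (by omega)
  have hb2 : a < 2 ^ (b + 1) := Nat.lt_pow_succ_log_self (by norm_num) a
  have hale : a < 2 ^ a := Nat.lt_two_pow_self
  have h := hC n (a - b - 2 * (64 + C) - 1) (by omega) (fun x hx => by
    have := hcon x hx
    omega)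
  have hk : a - b - 2 * (64 + C) - 1 + 1 = a - b - 2 * (64 + C) := by omega
  rw [hk] at h
  have e1 : 2 ^ a = 2 ^ (a - b - 2 * (64 + C)) * (2 ^ b * 2 ^ (2 * (64 + C))) := by
    rw [← pow_add, ← pow_add]
    congr 1
    omega
  have h2 : 2 ^ b * 2 ^ (2 * (64 + C)) < 32 * (a + 1) + C := by
    refine Nat.lt_of_mul_lt_mul_left (a := 2 ^ (a - b - 2 * (64 + C))) ?_
    rw [← e1]
    exact lt_of_le_of_lt han h
  have h3 : 2 * (64 + C) < 2 ^ (2 * (64 + C)) := Nat.lt_two_pow_self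
  rw [pow_succ] at hb2
  have h4 : 2 ^ b * (2 * (64 + C)) ≤ 2 ^ b * 2 ^ (2 * (64 + C)) := Nat.mul_le_mul_left _ h3.le
  have h5 : a * (64 + C) ≤ 2 ^ b * (2 * (64 + C)) := by
    calc a * (64 + C) ≤ (2 ^ b * 2) * (64 + C) := Nat.mul_le_mul_right _ hb2.le
      _ = _ := by ring
  nlinarith

end NonAdd

/-- There are a constant `c > 0` and infinitely many `n` with a binary string `x`
of length `n` such that `K(x) + K(y|x) − K(x,y) ≥ log n − log log n − c`,
where `y` is (the binary expansion of) `K(x)`. -/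
theorem nonadditivity_log (U : OptimalInterpreter) :
    ∃ c : ℕ, 0 < c ∧ ∀ N : ℕ, ∃ n : ℕ, N ≤ n ∧ ∃ x : List Bool, x.length = n ∧
      U.Kp (encode x) + U.K (U.Kp (encode x)) (encode x) +
          Nat.log 2 (Nat.log 2 n) + c ≥
        U.Kp (Nat.pair (encode x) (U.Kp (encode x))) + Nat.log 2 n := by
  obtain ⟨c₁, h₁⟩ := NonAdd.pair_le U
  obtain ⟨c₂, h₂⟩ := NonAdd.gacs U
  refine ⟨c₁ + c₂ + 1, by omega, fun N => ⟨N + 2, by omega, ?_⟩⟩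
  obtain ⟨x, hx, hK⟩ := h₂ (N + 2) (by omega)
  refine ⟨x, hx, ?_⟩
  have := h₁ (encode x)
  omega
end

section
/- Given b and K(b), the set of all programs of length K(b) that output b is computably enumerable uniformly in (b, K(b)), and its cardinality is bounded by a constant depending only on the universal machine. -/
open Encodable

namespace ShortProg

/-- Kraft's inequality for finite prefix-free sets. -/
theorem kraft (S : Finset (List Bool))
    (h : ∀ p ∈ S, ∀ q ∈ S, p <+: q → p = q) :
    ∑ p ∈ S, (1 / 2 : ℝ) ^ p.length ≤ 1 := by
  by_cases h0 : [] ∈ S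
  · have : S = {[]} := by
      ext q
      simp only [Finset.mem_singleton]
      constructor
      · intro hq
        exact (h _ h0 _ hq List.nil_prefix).symm
      · rintro rfl
        exact h0
    subst this
    simp
  · have hu : InformationTheory.UniquelyDecodable (S : Set (List Bool)) := by
      intro L₁
      induction L₁ with
      | nil =>
        intro L₂ _ h2 hf
        cases L₂ with
        | nil => rfl
        | cons a L =>
          have ha : a ∈ S := by simpa using h2 a (by simp)
          have : a = [] := by
            have := hf.symm
            simp at this
            exact this.1
          exact absurd (this ▸ ha) h0
      | cons a L₁ ih =>
        intro L₂ h1 h2 hf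
        have ha : a ∈ S := by simpa using h1 a (by simp)
        cases L₂ with
        | nil =>
          have : a = [] := by
            simp at hf
            exact hf.1
          exact absurd (this ▸ ha) h0
        | cons b L₂ =>
          have hb : b ∈ S := by simpa using h2 b (by simp)
          simp only [List.flatten_cons] at hf
          have hab : a = b := by
            rcases List.prefix_or_prefix_of_prefix (l₃ := a ++ L₁.flatten)
              (List.prefix_append a _) (hf ▸ List.prefix_append b _) with h' | h'
            · exact h _ ha _ hb h'
            · exact (h _ hb _ ha h').symm
          subst hab
          rw [ih L₂ (fun w hw => h1 w (by simp [hw])) (fun w hw => h2 w (by simp [hw]))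
            (List.append_cancel_left hf)]
    have := InformationTheory.kraft_mcmillan_inequality hu
    simpa using this

/-- Binary value of a bit string. -/
def val (p : List Bool) : ℕ := p.foldl (fun a b => 2 * a + cond b 1 0) 0

theorem foldl_val (p : List Bool) : ∀ a : ℕ,
    p.foldl (fun a b => 2 * a + cond b 1 0) a = a * 2 ^ p.length + val p := by
  induction p with
  | nil => intro a; simp [val]
  | cons x p ih =>
    intro a
    simp only [List.foldl_cons, val, List.length_cons]
    rw [ih, ih (2 * 0 + _)]
    ring

theorem val_append (p q : List Bool) : val (p ++ q) = val p * 2 ^ q.length + val q := by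
  rw [val, List.foldl_append, foldl_val]
  rfl

theorem val_lt (p : List Bool) : val p < 2 ^ p.length := by
  induction p using List.reverseRecOn with
  | nil => simp [val]
  | append_singleton p x ih =>
    rw [val_append, List.length_append, pow_add]
    cases x <;> simp [val] at * <;> omega

theorem exists_val (n : ℕ) : ∀ a < 2 ^ n, ∃ p : List Bool, p.length = n ∧ val p = a := by
  induction n with
  | zero => intro a ha; exact ⟨[], rfl, by simp at ha; simp [val, ha]⟩
  | succ n ih =>
    intro a ha
    obtain ⟨p, hp, hv⟩ := ih (a / 2) (by rw [pow_succ] at ha; omega)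
    refine ⟨p ++ [decide (a % 2 = 1)], by simp [hp], ?_⟩
    rw [val_append, hv]
    rcases Nat.mod_two_eq_zero_or_one a with h | h <;> simp [val, h] <;> omega

theorem primrec_val : Primrec val := by
  refine Primrec.list_foldl (h := fun _ x => 2 * x.1 + cond x.2 1 0) Primrec.id (Primrec.const 0) ?_
  refine Primrec.nat_add.comp (Primrec.nat_mul.comp (Primrec.const 2)
    (Primrec.fst.comp Primrec.snd)) ?_
  exact Primrec.cond (Primrec.snd.comp Primrec.snd) (Primrec.const 1) (Primrec.const 0)

theorem primrec_pow (a : ℕ) : Primrec fun n : ℕ => a ^ n := by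
  refine (Primrec.nat_rec₁ (f := fun _ x => x * a) 1
    (Primrec.nat_mul.comp Primrec.snd (Primrec.const a)).to₂).of_eq fun n => ?_
  induction n with
  | zero => rfl
  | succ n ih => rw [pow_succ, ← ih]

section Alloc

variable (v : ℕ → Bool) (l : ℕ → ℕ)

/-- scaled partial sums -/
def S : ℕ → ℕ := fun t =>
  Nat.rec 0 (fun t ih => 2 * ih + cond (v t) (2 ^ (t + 1 - l t)) 0) t

/-- real partial sums -/
noncomputable def s (t : ℕ) : ℝ := ∑ i ∈ Finset.range t, cond (v i) ((1 / 2 : ℝ) ^ l i) 0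

theorem S_eq (hl : ∀ t, l t ≤ t) (t : ℕ) : (S v l t : ℝ) = s v l t * 2 ^ t := by
  induction t with
  | zero => simp [S, s]
  | succ t ih =>
    have h1 : S v l (t + 1) = 2 * S v l t + cond (v t) (2 ^ (t + 1 - l t)) 0 := rfl
    rw [h1, s, Finset.sum_range_succ, ← s]
    push_cast
    rw [ih]
    cases h : v t
    · simp; ring
    · simp only [cond_true]
      push_cast
      rw [pow_sub₀ _ (by norm_num) (by have := hl t; omega)]
      simp
      ring

theorem s_mono : Monotone (s v l) := by
  refine monotone_nat_of_le_succ fun t => ?_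
  rw [s, s, Finset.sum_range_succ]
  have : (0 : ℝ) ≤ cond (v t) ((1 / 2 : ℝ) ^ l t) 0 := by
    cases v t <;> simp
  linarith

/-- The codeword test. -/
def mtch (p : List Bool) (t : ℕ) : Bool :=
  v t && (decide (p.length = l t + 1) && decide (val p = S v l t * 2 ^ (l t + 1) / 2 ^ t + 1))

theorem lo_hi (hl : ∀ t, l t ≤ t) (t : ℕ) (hv : v t = true) :
    s v l t * 2 ^ (l t + 1) < ((S v l t * 2 ^ (l t + 1) / 2 ^ t + 1 : ℕ) : ℝ) ∧
    ((S v l t * 2 ^ (l t + 1) / 2 ^ t + 1 : ℕ) : ℝ) + 1 ≤ s v l (t + 1) * 2 ^ (l t + 1) := by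
  set x := S v l t * 2 ^ (l t + 1) with hx
  have hxr : (x : ℝ) = s v l t * 2 ^ (l t + 1) * 2 ^ t := by
    rw [hx]; push_cast; rw [S_eq v l hl]; ring
  have h2 : (0 : ℝ) < 2 ^ t := by positivity
  have e1 : x < (x / 2 ^ t + 1) * 2 ^ t := by
    have := Nat.lt_div_mul_add (a := x) (b := 2 ^ t) (by positivity)
    linarith
  have e2 : x / 2 ^ t * 2 ^ t ≤ x := Nat.div_mul_le_self _ _
  have e1' : (x : ℝ) < ((x / 2 ^ t + 1 : ℕ) : ℝ) * 2 ^ t := by exact_mod_cast e1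
  have e2' : ((x / 2 ^ t : ℕ) : ℝ) * 2 ^ t ≤ x := by exact_mod_cast e2
  constructor
  · rw [hxr] at e1'
    exact lt_of_mul_lt_mul_right e1' h2.le
  · rw [hxr] at e2'
    have := le_of_mul_le_mul_right e2' h2
    rw [s, Finset.sum_range_succ, ← s, hv]
    have h3 : (1 / 2 : ℝ) ^ l t * 2 ^ (l t + 1) = 2 := by
      rw [pow_succ, ← mul_assoc, ← mul_pow]; norm_num
    simp only [cond_true]
    rw [add_mul, h3]
    push_cast
    linarith

theorem mtch_prefix (hl : ∀ t, l t ≤ t) {p q : List Bool} {t u : ℕ} (hpq : p <+: q)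
    (hp : mtch v l p t = true) (hq : mtch v l q u = true) : p = q ∧ t = u := by
  simp only [mtch, Bool.and_eq_true, decide_eq_true_eq] at hp hq
  obtain ⟨hv, hlp, hvp⟩ := hp
  obtain ⟨hv', hlq, hvq⟩ := hq
  have A := lo_hi v l hl t hv
  have B := lo_hi v l hl u hv'
  rw [← hvp, ← hlp] at A
  rw [← hvq, ← hlq] at B
  obtain ⟨r, rfl⟩ := hpq
  have hr := val_lt r
  rw [val_append, List.length_append, pow_add] at B
  have hr' : (val r : ℝ) + 1 ≤ 2 ^ r.length := by exact_mod_cast hr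
  push_cast at B
  have P1 : (0 : ℝ) < 2 ^ p.length := by positivity
  have P2 : (0 : ℝ) < 2 ^ r.length := by positivity
  have hr0 : (0 : ℝ) ≤ val r := by positivity
  obtain ⟨A1, A2⟩ := A
  obtain ⟨B1, B2⟩ := B
  have A1' := mul_lt_mul_of_pos_right A1 P2
  have A2' := mul_le_mul_of_nonneg_right A2 P2.le
  have htu : t = u := by
    rcases lt_trichotomy t u with h | h | h
    · exfalso
      have := mul_le_mul_of_nonneg_right (s_mono v l (show t + 1 ≤ u from h))
        (mul_pos P1 P2).le
      nlinarith
    · exact h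
    · exfalso
      have := mul_le_mul_of_nonneg_right (s_mono v l (show u + 1 ≤ t from h))
        (mul_pos P1 P2).le
      nlinarith
  subst htu
  refine ⟨?_, rfl⟩
  have : r.length = 0 := by
    rw [List.length_append] at hlq; omega
  simp [List.length_eq_zero_iff.mp this]

theorem primrec_S (hv : Primrec v) (hl : Primrec l) : Primrec (S v l) := by
  refine Primrec.nat_rec₁ (f := fun t ih => 2 * ih + cond (v t) (2 ^ (t + 1 - l t)) 0) 0 ?_
  refine Primrec.nat_add.comp (Primrec.nat_mul.comp (Primrec.const 2) Primrec.snd) ?_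
  refine Primrec.cond (hv.comp Primrec.fst) ?_ (Primrec.const 0)
  exact (primrec_pow 2).comp (Primrec.nat_sub.comp (Primrec.succ.comp Primrec.fst)
    (hl.comp Primrec.fst))

theorem primrec_mtch (hv : Primrec v) (hl : Primrec l) : Primrec₂ (mtch v l) := by
  refine Primrec.and.comp (hv.comp Primrec.snd) (Primrec.and.comp ?_ ?_)
  · exact (Primrec.eq.decide).comp (Primrec.list_length.comp Primrec.fst)
      (Primrec.succ.comp (hl.comp Primrec.snd))
  · refine (Primrec.eq.decide).comp (primrec_val.comp Primrec.fst)
      (Primrec.succ.comp (Primrec.nat_div.comp (Primrec.nat_mul.comp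
        ((primrec_S v l hv hl).comp Primrec.snd) ((primrec_pow 2).comp
          (Primrec.succ.comp (hl.comp Primrec.snd)))) ((primrec_pow 2).comp Primrec.snd)))

/-- Effective Kraft: a computable list of requests of total weight at most `1` is served
by the optimal machine up to an additive constant. -/
theorem alloc (U : OptimalInterpreter) (r : ℕ → ℕ) (hv : Primrec v) (hlp : Primrec l)
    (hr : Primrec r) (hl : ∀ t, l t ≤ t) (hs : ∀ t, s v l t ≤ 1) :
    ∃ c : ℕ, ∀ t, v t = true → ∃ q : List Bool, r t ∈ U.Φ q 0 ∧ q.length ≤ l t + c := by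
  let g : List Bool → ℕ → Option ℕ := fun p t => cond (mtch v l p t) (some (r t)) none
  let ψ : List Bool → ℕ → Part ℕ := fun p _ => Nat.rfindOpt (g p)
  have hg : Primrec₂ g := by
    refine Primrec.cond (primrec_mtch v l hv hlp) ?_ (Primrec.const none)
    exact Primrec.option_some.comp (hr.comp Primrec.snd)
  have hψ : Partrec₂ ψ := by
    refine Partrec.rfindOpt (f := fun (a : List Bool × ℕ) t => g a.1 t) ?_
    exact (hg.comp (Primrec.fst.comp Primrec.fst) Primrec.snd).to_comp
  have key : ∀ p t x, x ∈ g p t → mtch v l p t = true ∧ x = r t := by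
    intro p t x hx
    simp only [g] at hx
    cases h : mtch v l p t <;> simp_all
  obtain ⟨c, hc⟩ := U.optimal ψ hψ (by
    intro y p q hpq hp hq
    obtain ⟨t, x, hx⟩ := Nat.rfindOpt_dom.1 hp
    obtain ⟨u, z, hz⟩ := Nat.rfindOpt_dom.1 hq
    exact (mtch_prefix v l hl hpq (key _ _ _ hx).1 (key _ _ _ hz).1).1)
  refine ⟨1 + c, fun t ht => ?_⟩
  have A := (lo_hi v l hl t ht).2
  have hlt : S v l t * 2 ^ (l t + 1) / 2 ^ t + 1 < 2 ^ (l t + 1) := by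
    have h1 : s v l (t + 1) * 2 ^ (l t + 1) ≤ 1 * 2 ^ (l t + 1) :=
      mul_le_mul_of_nonneg_right (hs _) (by positivity)
    have h2 := A.trans h1
    rw [one_mul] at h2
    have : S v l t * 2 ^ (l t + 1) / 2 ^ t + 1 + 1 ≤ 2 ^ (l t + 1) := by exact_mod_cast h2
    omega
  obtain ⟨p, hp, hpv⟩ := exists_val _ _ hlt
  have hm : mtch v l p t = true := by
    simp only [mtch, Bool.and_eq_true, decide_eq_true_eq]
    exact ⟨ht, hp, hpv⟩
  have hd : (Nat.rfindOpt (g p)).Dom := Nat.rfindOpt_dom.2 ⟨t, r t, by simp [g, hm]⟩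
  have hmem : r t ∈ ψ p 0 := by
    have h1 := Part.get_mem hd
    obtain ⟨u, hu⟩ := Nat.rfindOpt_spec h1
    obtain ⟨h3, h4⟩ := key _ _ _ hu
    have := (mtch_prefix v l hl (List.prefix_refl p) hm h3).2
    rw [h4, ← this] at h1
    exact h1
  obtain ⟨q, hq, hq'⟩ := hc _ _ _ hmem
  exact ⟨q, hq, by omega⟩

end Alloc

theorem val_inj (p : List Bool) : ∀ q : List Bool, p.length = q.length → val p = val q → p = q := by
  induction p with
  | nil =>
    intro q h _
    exact (List.length_eq_zero_iff.1 h.symm).symm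
  | cons x p ih =>
    intro q h hv
    cases q with
    | nil => simp at h
    | cons y q =>
      have hl : p.length = q.length := by simpa using h
      rw [← List.singleton_append, ← List.singleton_append (l := q), val_append, val_append,
        hl] at hv
      have h1 := val_lt p
      have h2 := val_lt q
      rw [hl] at h1
      cases x <;> cases y <;> simp [val] at hv <;>
        first
        | (rw [ih q hl (by simpa [val] using hv)])
        | (exfalso; simp only [val] at h1 h2; omega)

open Nat.Partrec (Code)

/-- Stage-`s` test whether the string with code `n` has length `k` and produces `b`. -/
def hit (c : Code) (b k s n : ℕ) : Option (List Bool) :=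
  (decode (α := List Bool) n).bind fun p =>
    if encode p = n ∧ p.length = k ∧ c.evaln s (encode (p, (0 : ℕ))) = some b then some p else none

theorem hit_eq_some (c : Code) (b k s n : ℕ) (p : List Bool) :
    hit c b k s n = some p ↔
      encode p = n ∧ p.length = k ∧ c.evaln s (encode (p, (0 : ℕ))) = some b := by
  unfold hit
  rw [Option.bind_eq_some_iff]
  constructor
  · rintro ⟨q, hq, h⟩
    split_ifs at h with h'
    cases h
    exact h'
  · rintro ⟨rfl, h⟩
    exact ⟨p, encodek p, if_pos ⟨rfl, h⟩⟩

theorem primrec_hit (c : Code) :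
    Primrec fun a : ((ℕ × ℕ) × ℕ) × ℕ => hit c a.1.1.1 a.1.1.2 a.1.2 a.2 := by
  refine Primrec.option_bind (Primrec.decode.comp Primrec.snd) ?_
  refine Primrec.ite (PrimrecPred.and ?_ (PrimrecPred.and ?_ ?_))
    (Primrec.option_some.comp Primrec.snd) (Primrec.const none)
  · exact Primrec.eq.comp (Primrec.encode.comp Primrec.snd) (Primrec.snd.comp Primrec.fst)
  · exact Primrec.eq.comp (Primrec.list_length.comp Primrec.snd)
      (Primrec.snd.comp (Primrec.fst.comp (Primrec.fst.comp Primrec.fst)))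
  · refine Primrec.eq.comp (Code.primrec_evaln.comp (Primrec.pair (Primrec.pair
      (Primrec.snd.comp (Primrec.fst.comp Primrec.fst)) (Primrec.const c))
      (Primrec.encode.comp (Primrec.pair Primrec.snd (Primrec.const 0))))) ?_
    exact Primrec.option_some.comp
      (Primrec.fst.comp (Primrec.fst.comp (Primrec.fst.comp Primrec.fst)))

/-- All programs of length `k` seen to produce `b` by stage `s`. -/
def hits (c : Code) (b k s : ℕ) : List (List Bool) := (List.range s).filterMap (hit c b k s)

theorem mem_hits (c : Code) (b k s : ℕ) (p : List Bool) :
    p ∈ hits c b k s ↔ p.length = k ∧ c.evaln s (encode (p, (0 : ℕ))) = some b := by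
  simp only [hits, List.mem_filterMap, hit_eq_some, List.mem_range]
  constructor
  · rintro ⟨n, _, _, h⟩
    exact h
  · intro h
    refine ⟨encode p, ?_, rfl, h⟩
    have := Code.evaln_bound (Option.mem_def.2 h.2)
    rw [Encodable.encode_prod_val] at this
    exact (Nat.left_le_pair _ _).trans_lt this

theorem nodup_hits (c : Code) (b k s : ℕ) : (hits c b k s).Nodup := by
  refine List.Nodup.filterMap ?_ List.nodup_range
  intro n n' p h h'
  rw [Option.mem_def, hit_eq_some] at h h'
  rw [← h.1, ← h'.1]

/-- Number of programs seen. -/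
def cnt (c : Code) (b k s : ℕ) : ℕ := (hits c b k s).length

theorem cnt_mono (c : Code) (b k : ℕ) : Monotone (cnt c b k) := by
  intro s s' h
  refine ((nodup_hits c b k s).subperm ?_).length_le
  intro p hp
  rw [mem_hits] at *
  exact ⟨hp.1, Code.evaln_mono h hp.2⟩

theorem primrec_cnt (c : Code) : Primrec fun a : (ℕ × ℕ) × ℕ => cnt c a.1.1 a.1.2 a.2 := by
  refine Primrec.list_length.comp ?_
  exact Primrec.listFilterMap (Primrec.list_range.comp Primrec.snd) (primrec_hit c)

/-- request coordinates -/
def rb (t : ℕ) : ℕ := t.unpair.1.unpair.1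
/-- request coordinates -/
def rk (t : ℕ) : ℕ := t.unpair.1.unpair.2
/-- request coordinates -/
def rm (t : ℕ) : ℕ := t.unpair.2.unpair.1
/-- request coordinates -/
def rs (t : ℕ) : ℕ := t.unpair.2.unpair.2

theorem r_ext {t u : ℕ} (h1 : rb t = rb u) (h2 : rk t = rk u) (h3 : rm t = rm u)
    (h4 : rs t = rs u) : t = u := by
  unfold rb rk rm rs at *
  rw [← Nat.pair_unpair t, ← Nat.pair_unpair u, ← Nat.pair_unpair t.unpair.1,
    ← Nat.pair_unpair t.unpair.2, h1, h2, h3, h4, Nat.pair_unpair, Nat.pair_unpair]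

theorem primrec_rb : Primrec rb :=
  Primrec.fst.comp (Primrec.unpair.comp (Primrec.fst.comp Primrec.unpair))
theorem primrec_rk : Primrec rk :=
  Primrec.snd.comp (Primrec.unpair.comp (Primrec.fst.comp Primrec.unpair))
theorem primrec_rm : Primrec rm :=
  Primrec.fst.comp (Primrec.unpair.comp (Primrec.snd.comp Primrec.unpair))
theorem primrec_rs : Primrec rs :=
  Primrec.snd.comp (Primrec.unpair.comp (Primrec.snd.comp Primrec.unpair))

/-- length requested -/
def rl (t : ℕ) : ℕ := rk t - (rm t + 1)

theorem primrec_rl : Primrec rl := Primrec.nat_sub.comp primrec_rk (Primrec.succ.comp primrec_rm)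

theorem rl_le (t : ℕ) : rl t ≤ t :=
  (Nat.sub_le _ _).trans ((Nat.unpair_right_le _).trans (Nat.unpair_left_le _))

/-- valid request: the count crosses `4 ^ (m + 1)` exactly after stage `s`. -/
def rv (c : Code) (t : ℕ) : Bool :=
  decide (cnt c (rb t) (rk t) (rs t) < 4 ^ (rm t + 1)) &&
    decide (4 ^ (rm t + 1) ≤ cnt c (rb t) (rk t) (rs t + 1))

theorem primrec_rv (c : Code) : Primrec (rv c) := by
  have hp : Primrec fun t => 4 ^ (rm t + 1) :=
    (primrec_pow 4).comp (Primrec.succ.comp primrec_rm)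
  refine Primrec.and.comp (Primrec.nat_lt.decide.comp ?_ hp) (Primrec.nat_le.decide.comp hp ?_)
  · exact (primrec_cnt c).comp (Primrec.pair (Primrec.pair primrec_rb primrec_rk) primrec_rs)
  · exact (primrec_cnt c).comp (Primrec.pair (Primrec.pair primrec_rb primrec_rk)
      (Primrec.succ.comp primrec_rs))

theorem rv_iff (c : Code) (t : ℕ) : rv c t = true ↔
    cnt c (rb t) (rk t) (rs t) < 4 ^ (rm t + 1) ∧
      4 ^ (rm t + 1) ≤ cnt c (rb t) (rk t) (rs t + 1) := by
  simp [rv]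

theorem rv_inj (c : Code) {t u : ℕ} (ht : rv c t = true) (hu : rv c u = true)
    (h1 : rb t = rb u) (h2 : rk t = rk u) (h3 : rm t = rm u) : t = u := by
  refine r_ext h1 h2 h3 ?_
  rw [rv_iff] at ht hu
  rw [h1, h2, h3] at ht
  rcases lt_trichotomy (rs t) (rs u) with h | h | h
  · have := cnt_mono c (rb u) (rk u) (show rs t + 1 ≤ rs u from h)
    omega
  · exact h
  · have := cnt_mono c (rb u) (rk u) (show rs u + 1 ≤ rs t from h)
    omega

/-- Total weight of the valid requests. -/
theorem weight (c : Code)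
    (hpf : ∀ p q : List Bool, p <+: q → (c.eval (encode (p, (0 : ℕ)))).Dom →
      (c.eval (encode (q, (0 : ℕ)))).Dom → p = q) (T : ℕ) : s (rv c) rl T ≤ 1 := by
  classical
  let V : Finset ℕ := (Finset.range T).filter fun t => rv c t = true
  let H : ℕ → Finset (List Bool) := fun t => (hits c (rb t) (rk t) (rs t + 1)).toFinset
  let F : Finset (List Bool) := V.biUnion H
  have hH : ∀ t p, p ∈ H t ↔ p.length = rk t ∧
      c.evaln (rs t + 1) (encode (p, (0 : ℕ))) = some (rb t) := by
    intro t p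
    simp only [H, List.mem_toFinset, mem_hits]
  have hcard : ∀ t ∈ V, (4 : ℝ) ^ (rm t + 1) ≤ (H t).card := by
    intro t ht
    have h1 := ((rv_iff c t).1 (Finset.mem_filter.1 ht).2).2
    have h2 : (H t).card = cnt c (rb t) (rk t) (rs t + 1) :=
      List.toFinset_card_of_nodup (nodup_hits _ _ _ _)
    rw [← h2] at h1
    exact_mod_cast h1
  have hw : ∀ t ∈ V, (1 / 2 : ℝ) ^ rl t ≤
      ∑ p ∈ F, if p ∈ H t then (1 / 2 : ℝ) ^ p.length * (1 / 2) ^ (rm t + 1) else 0 := by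
    intro t ht
    have hsub : F.filter (fun p => p ∈ H t) = H t := by
      ext p
      simp only [Finset.mem_filter, F, Finset.mem_biUnion]
      exact ⟨fun h => h.2, fun h => ⟨⟨t, ht, h⟩, h⟩⟩
    rw [← Finset.sum_filter, hsub]
    have : ∑ p ∈ H t, (1 / 2 : ℝ) ^ p.length * (1 / 2) ^ (rm t + 1) =
        (H t).card * ((1 / 2 : ℝ) ^ rk t * (1 / 2) ^ (rm t + 1)) := by
      rw [← nsmul_eq_mul, ← Finset.sum_const]
      refine Finset.sum_congr rfl fun p hp => ?_
      rw [((hH t p).1 hp).1]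
    rw [this]
    have h4 : (4 : ℝ) ^ (rm t + 1) * (1 / 2) ^ (rm t + 1) * (1 / 2) ^ (rm t + 1) = 1 := by
      rw [← mul_pow, ← mul_pow]; norm_num
    calc (1 / 2 : ℝ) ^ rl t
        = (4 : ℝ) ^ (rm t + 1) * ((1 / 2 : ℝ) ^ (rl t + (rm t + 1)) * (1 / 2) ^ (rm t + 1)) := by
          rw [pow_add]
          linear_combination (-(1 / 2 : ℝ) ^ rl t) * h4
      _ ≤ (4 : ℝ) ^ (rm t + 1) * ((1 / 2 : ℝ) ^ rk t * (1 / 2) ^ (rm t + 1)) := by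
          refine mul_le_mul_of_nonneg_left (mul_le_mul_of_nonneg_right ?_ (by positivity))
            (by positivity)
          refine pow_le_pow_of_le_one (by norm_num) (by norm_num) ?_
          unfold rl
          omega
      _ ≤ _ := mul_le_mul_of_nonneg_right (hcard t ht) (by positivity)
  have hin : ∀ p ∈ F, ∑ t ∈ V.filter (fun t => p ∈ H t), (1 / 2 : ℝ) ^ (rm t + 1) ≤ 1 := by
    intro p _
    have hinj : Set.InjOn rm (V.filter (fun t => p ∈ H t) : Finset ℕ) := by
      intro t ht u hu h
      simp only [Finset.coe_filter, Set.mem_ofPred_eq, V, Finset.mem_filter, hH] at ht hu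
      refine rv_inj c ht.1.2 hu.1.2 ?_ (ht.2.1.symm.trans hu.2.1) h
      exact Part.mem_unique (Code.evaln_sound (Option.mem_def.2 ht.2.2))
        (Code.evaln_sound (Option.mem_def.2 hu.2.2))
    rw [← Finset.sum_image (f := fun m => (1 / 2 : ℝ) ^ (m + 1)) hinj]
    have h2 : HasSum (fun m : ℕ => (1 / 2 : ℝ) ^ (m + 1)) 1 := by
      have := hasSum_geometric_two.mul_right (1 / 2 : ℝ)
      simpa [pow_succ] using this
    exact sum_le_hasSum _ (fun _ _ => by positivity) h2
  have hk : ∑ p ∈ F, (1 / 2 : ℝ) ^ p.length ≤ 1 := by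
    have hd : ∀ p ∈ F, (c.eval (encode (p, (0 : ℕ)))).Dom := by
      intro p hp
      obtain ⟨t, _, ht⟩ := Finset.mem_biUnion.1 hp
      exact Part.dom_iff_mem.2 ⟨_, Code.evaln_sound (Option.mem_def.2 ((hH t p).1 ht).2)⟩
    exact kraft F fun p hp q hq h => hpf p q h (hd p hp) (hd q hq)
  calc s (rv c) rl T = ∑ t ∈ V, (1 / 2 : ℝ) ^ rl t := by
        rw [s, Finset.sum_filter]
        refine Finset.sum_congr rfl fun t _ => ?_
        cases rv c t <;> simp
    _ ≤ ∑ t ∈ V, ∑ p ∈ F,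
        if p ∈ H t then (1 / 2 : ℝ) ^ p.length * (1 / 2) ^ (rm t + 1) else 0 :=
        Finset.sum_le_sum hw
    _ = ∑ p ∈ F, (1 / 2 : ℝ) ^ p.length *
          ∑ t ∈ V.filter (fun t => p ∈ H t), (1 / 2 : ℝ) ^ (rm t + 1) := by
        rw [Finset.sum_comm]
        refine Finset.sum_congr rfl fun p _ => ?_
        rw [← Finset.sum_filter, Finset.mul_sum]
    _ ≤ ∑ p ∈ F, (1 / 2 : ℝ) ^ p.length * 1 :=
        Finset.sum_le_sum fun p hp => mul_le_mul_of_nonneg_left (hin p hp) (by positivity)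
    _ ≤ 1 := by simpa using hk

theorem exists_code (U : OptimalInterpreter) : ∃ c : Code, ∀ p : List Bool,
    c.eval (encode (p, (0 : ℕ))) = U.Φ p 0 := by
  obtain ⟨c, hc⟩ := Code.exists_code.1 U.partrec
  refine ⟨c, fun p => ?_⟩
  rw [hc]
  simp only [encodek, Part.coe_some, Part.bind_some]
  exact Part.map_id' (fun _ => rfl) _

theorem enum (U : OptimalInterpreter) (c : Code)
    (hc : ∀ p : List Bool, c.eval (encode (p, (0 : ℕ))) = U.Φ p 0) :
    ∃ f : ℕ → ℕ → Option (List Bool), Computable₂ f ∧ ∀ b : ℕ,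
      {p : List Bool | ∃ n : ℕ, f (Nat.pair b (U.Kp b)) n = some p} =
        {p : List Bool | p.length = U.Kp b ∧ b ∈ U.Φ p 0} := by
  refine ⟨fun x n => hit c x.unpair.1 x.unpair.2 n.unpair.2 n.unpair.1, ?_, ?_⟩
  · refine Primrec.to_comp ((primrec_hit c).comp (Primrec.pair (Primrec.pair
      (Primrec.unpair.comp Primrec.fst)
      (Primrec.snd.comp (Primrec.unpair.comp Primrec.snd)))
      (Primrec.fst.comp (Primrec.unpair.comp Primrec.snd))))
  · intro b
    ext p
    simp only [Nat.unpair_pair, Set.mem_ofPred_eq, hit_eq_some, ← hc, Code.evaln_complete]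
    constructor
    · rintro ⟨n, _, h1, h2⟩
      exact ⟨h1, _, h2⟩
    · rintro ⟨h1, k, h2⟩
      exact ⟨Nat.pair (encode p) k, by simpa using ⟨h1, h2⟩⟩

theorem few (U : OptimalInterpreter) (c : Code)
    (hc : ∀ p : List Bool, c.eval (encode (p, (0 : ℕ))) = U.Φ p 0) :
    ∃ C : ℕ, ∀ b : ℕ, {p : List Bool | p.length = U.Kp b ∧ b ∈ U.Φ p 0}.ncard ≤ C := by
  obtain ⟨d, hd⟩ := alloc (rv c) rl U rb (primrec_rv c) primrec_rl primrec_rb rl_le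
    (weight c (by simp only [hc]; exact U.prefixFree 0))
  refine ⟨4 ^ (d + 1), fun b => ?_⟩
  by_contra! hlt
  set A := {p : List Bool | p.length = U.Kp b ∧ b ∈ U.Φ p 0} with hA
  have hfin : A.Finite := Set.finite_of_ncard_ne_zero (Nat.ne_zero_of_lt hlt)
  -- every program in `A` is seen at a common stage
  have hst : ∃ s, ∀ p ∈ A, p ∈ hits c b (U.Kp b) s := by
    have : ∀ p ∈ A, ∃ s, p ∈ hits c b (U.Kp b) s := by
      rintro p ⟨h1, h2⟩
      rw [← hc, Code.evaln_complete] at h2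
      obtain ⟨k, hk⟩ := h2
      exact ⟨k, (mem_hits _ _ _ _ _).2 ⟨h1, hk⟩⟩
    choose! g hg using this
    refine ⟨hfin.toFinset.sup g, fun p hp => ?_⟩
    have h1 := hg p hp
    rw [mem_hits] at *
    exact ⟨h1.1, Code.evaln_mono
      (Finset.le_sup (f := g) (hfin.mem_toFinset.2 hp)) h1.2⟩
  have hex : ∃ s, 4 ^ (d + 1) ≤ cnt c b (U.Kp b) s := by
    obtain ⟨s, hs⟩ := hst
    refine ⟨s, hlt.le.trans ?_⟩
    rw [Set.ncard_eq_toFinset_card A hfin]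
    refine (Finset.card_le_card (t := (hits c b (U.Kp b) s).toFinset) ?_).trans
      (List.toFinset_card_le _)
    intro p hp
    simpa using hs p (hfin.mem_toFinset.1 hp)
  classical
  have hf := Nat.find_spec hex
  have hmin := fun {m} => Nat.find_min hex (m := m)
  rcases h : Nat.find hex with _ | s
  · rw [h] at hf
    simp [cnt, hits] at hf
  · rw [h] at hf hmin
    have hmin := hmin (Nat.lt_succ_self s)
    set t := Nat.pair (Nat.pair b (U.Kp b)) (Nat.pair d s) with ht
    have e1 : rb t = b := by simp [rb, ht]
    have e2 : rk t = U.Kp b := by simp [rk, ht]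
    have e3 : rm t = d := by simp [rm, ht]
    have e4 : rs t = s := by simp [rs, ht]
    obtain ⟨q, hq, hql⟩ := hd t (by rw [rv_iff, e1, e2, e3, e4]; exact ⟨not_le.1 hmin, hf⟩)
    rw [e1] at hq
    rw [rl, e2, e3] at hql
    have hK : U.Kp b ≤ q.length := Nat.sInf_le ⟨q, rfl, hq⟩
    have hKd : U.Kp b ≤ d := by omega
    have hcard : A.ncard ≤ 2 ^ U.Kp b := by
      have h1 : A.ncard ≤ (Finset.range (2 ^ U.Kp b) : Set ℕ).ncard := by
        refine Set.ncard_le_ncard_of_injOn val ?_ ?_ (Finset.finite_toSet _)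
        · intro p hp
          have := val_lt p
          rw [hp.1] at this
          simpa using this
        · intro p hp q hq h
          exact val_inj p q (hp.1.trans hq.1.symm) h
      simpa using h1
    have h5 : 2 ^ U.Kp b ≤ 2 ^ d := Nat.pow_le_pow_right (by norm_num) hKd
    have h6 : 2 ^ d ≤ 4 ^ d := Nat.pow_le_pow_left (by norm_num) d
    rw [pow_succ] at hlt
    omega

end ShortProg

/-- Given `b` and `K(b)`, the set of programs of length `K(b)` outputting `b` is
computably enumerable uniformly in `(b, K(b))`, and its cardinality is bounded by
a constant depending only on the universal machine. -/
theorem shortest_programs_enumerable_and_few (U : OptimalInterpreter) :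
    (∃ f : ℕ → ℕ → Option (List Bool), Computable₂ f ∧ ∀ b : ℕ,
      {p : List Bool | ∃ n : ℕ, f (Nat.pair b (U.Kp b)) n = some p} =
        {p : List Bool | p.length = U.Kp b ∧ b ∈ U.Φ p 0}) ∧
    (∃ C : ℕ, ∀ b : ℕ,
      {p : List Bool | p.length = U.Kp b ∧ b ∈ U.Φ p 0}.ncard ≤ C) := by
  obtain ⟨c, hc⟩ := ShortProg.exists_code U
  exact ⟨ShortProg.enum U c hc, ShortProg.few U c hc⟩
end
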